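/- Let T be a Galton-Watson tree with offspring law p on the nonnegative integers satisfying 0 < p(0) < 1 - p(1), mean one (∑_ℓ ℓ p(ℓ) = 1), and ℓ^{-1about} log p(ℓ) → -∞ as ℓ → ∞. Let X be a Markov chain indexed by T, with arbitrary initial distribution and irreducible transition kernel Q on a finite alphabet 𝒳. Then, as n → ∞ along the integers n with P{|T| = n} > 0, the empirical pair measure L_X, conditioned on {|T| = n}, satisfies a large deviation principle in the space of probability vectors on 𝒳 × 𝒳 with speed n and the convex good rate function I(μ) = H(μ ∥ μ₁ ⊗ Q) + ∑_{a∈𝒳} μ₂(a) I_p(μ₁(a)/μ₂(a)) if μ₁ ≪ μ₂, and I(μ) = ∞ otherwise; here μ₁, μ₂ are the first and second marginals of μ and μ₁ ⊗ Q(a,b) = Q{b|a} μ₁(a). -/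

import Mathlib

open scoped ENNReal NNReal BigOperators
open Filter

/-- Finite rooted planar trees with vertex types in `𝒳`. -/
inductive PTree (𝒳 : Type*) where
  | node : 𝒳 → List (PTree 𝒳) → PTree 𝒳

namespace PTree

variable {𝒳 : Type*}

/-- The type of the root. -/
def root : PTree 𝒳 → 𝒳
  | node a _ => a

/-- The list of subtrees rooted at the children of the root (left to right). -/
def children : PTree 𝒳 → List (PTree 𝒳)
  | node _ ts => ts

/-- The types of the children of the root, from left to right. -/
def childLabels (t : PTree 𝒳) : List 𝒳 := t.children.map root

/-- The list of all subtrees `X^v`, `v` a vertex of the tree. -/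
def subtrees : PTree 𝒳 → List (PTree 𝒳)
  | node a ts => node a ts :: (ts.attach.map (fun s => subtrees s.1)).flatten
decreasing_by
  have := List.sizeOf_lt_of_mem s.2
  simp only [PTree.node.sizeOf_spec]
  omega

/-- Number of vertices. -/
def size (t : PTree 𝒳) : ℕ := t.subtrees.length

/-- The vertices at depth exactly `k`, as subtrees, from left to right. -/
def atDepth : ℕ → PTree 𝒳 → List (PTree 𝒳)
  | 0, t => [t]
  | (k+1), node _ ts => (ts.attach.map (fun s => atDepth k s.1)).flatten

/-- Truncation of a tree at height `k` (keeping the generations `0,…,k`). -/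
def trunc : ℕ → PTree 𝒳 → PTree 𝒳
  | 0, node a _ => node a []
  | (k+1), node a ts => node a (ts.attach.map (fun s => trunc k s.1))

/-- The height of a tree (largest `k` such that generation `k` is nonempty). -/
def height : PTree 𝒳 → ℕ
  | node _ [] => 0
  | node _ (t :: ts) => ((t :: ts).attach.map (fun s => height s.1)).foldr max 0 + 1
decreasing_by
  have := List.sizeOf_lt_of_mem s.2
  simp only [PTree.node.sizeOf_spec] at *
  omega

/-- The largest offspring number in the tree. -/
def maxDeg : PTree 𝒳 → ℕ
  | node _ ts => max ts.length (((ts.attach.map (fun s => maxDeg s.1)).foldr max 0))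
decreasing_by
  have := List.sizeOf_lt_of_mem s.2
  simp only [PTree.node.sizeOf_spec] at *
  omega

end PTree
noncomputable instance {𝒳 : Type*} : DecidableEq (PTree 𝒳) := Classical.decEq _

/-- Extended-real logarithm of an extended nonnegative real. -/
noncomputable def elog (x : ℝ≥0∞) : EReal :=
  if x = 0 then ⊥ else if x = ∞ then ⊤ else ((Real.log x.toReal : ℝ) : EReal)

open Classical in
/-- Relative entropy `H(ν ‖ ρ)` of two (probability) vectors on a countable set,
with value `∞` if `ν` is not absolutely continuous with respect to `ρ`.  (For
probability vectors each summand below is nonnegative and the sum equals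
`∑ ν a log (ν a / ρ a)`.) -/
noncomputable def relEnt {α : Type*} (ν ρ : α → ℝ) : ℝ≥0∞ :=
  if ∀ a, ρ a = 0 → ν a = 0 then
    ∑' a, ENNReal.ofReal (ν a * Real.log (ν a / ρ a) + ρ a - ν a)
  else ∞

/-- The Cramér rate function `I_p(x) = sup_λ {λx - log ∑ p(n) e^{λn}}`. -/
noncomputable def cramerRate (p : ℕ → ℝ) (x : ℝ) : EReal :=
  ⨆ lam : ℝ, ((lam * x - Real.log (∑' n : ℕ, p n * Real.exp (lam * n)) : ℝ) : EReal)

/-- Total mass `P{|T| = n}` assigned by the weight `w` to trees with `n` vertices. -/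
noncomputable def treeMass {𝒳 : Type*} (w : PTree 𝒳 → ℝ) (n : ℕ) : ℝ≥0∞ :=
  ∑' t : PTree 𝒳, if t.size = n then ENNReal.ofReal (w t) else 0

open Classical in
/-- Conditional probability of the event `E` given `{|T| = n}`, for the (sub)probability
weight `w` on finite planar trees.  -/
noncomputable def condP {𝒳 : Type*} (w : PTree 𝒳 → ℝ) (n : ℕ) (E : Set (PTree 𝒳)) : ℝ≥0∞ :=
  (∑' t : PTree 𝒳, if t.size = n ∧ t ∈ E then ENNReal.ofReal (w t) else 0) / treeMass w n

/-- The set of sizes having positive probability. -/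
noncomputable def sizeSupport {𝒳 : Type*} (w : PTree 𝒳 → ℝ) : Set ℕ := {n | 0 < treeMass w n}
section TreeIndexedChain

variable {𝒳 : Type*} [Fintype 𝒳] [DecidableEq 𝒳]

/-- The joint weight of a typed tree under the Galton-Watson law with offspring
distribution `p`, initial type distribution `μ0` and Markov transition kernel `Q`:
`μ0(root) ∏_v p(N(v)) ∏_{children w of v} Q(type w | type v)`. -/
noncomputable def jointWeight (p : ℕ → ℝ) (μ0 : 𝒳 → ℝ) (Q : 𝒳 → 𝒳 → ℝ) (t : PTree 𝒳) : ℝ :=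
  μ0 t.root *
    (t.subtrees.map (fun s => p s.children.length *
      (s.children.map (fun c => Q s.root c.root)).prod)).prod

/-- The number of edges of `t` whose beginning vertex has type `a` and whose end
vertex has type `b`. -/
noncomputable def pairCount (t : PTree 𝒳) (a b : 𝒳) : ℕ :=
  (t.subtrees.map (fun s => if s.root = a then s.childLabels.count b else 0)).sum

/-- The empirical pair measure `L_X`. -/
noncomputable def empPair (t : PTree 𝒳) : 𝒳 × 𝒳 → ℝ :=
  fun x => (pairCount t x.1 x.2 : ℝ) / ((t.size : ℝ) - 1)

/-- Probability vectors on `𝒳 × 𝒳`. -/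
def IsProbVec (μ : 𝒳 × 𝒳 → ℝ) : Prop := (∀ x, 0 ≤ μ x) ∧ ∑ x, μ x = 1

/-- The space of probability vectors on `𝒳 × 𝒳` (with its natural topology). -/
abbrev PV (𝒳 : Type*) [Fintype 𝒳] [DecidableEq 𝒳] := {μ : 𝒳 × 𝒳 → ℝ // IsProbVec μ}

end TreeIndexedChain
section Statement0

variable {𝒳 : Type*} [Fintype 𝒳] [DecidableEq 𝒳]

open Classical in
/-- The rate function of Theorem 1:
`I(μ) = H(μ ‖ μ₁ ⊗ Q) + ∑_a μ₂(a) I_p(μ₁(a)/μ₂(a))` if `μ₁ ≪ μ₂`, `∞` otherwise. -/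
noncomputable def rateGWPair (p : ℕ → ℝ) (Q : 𝒳 → 𝒳 → ℝ) (μ : 𝒳 × 𝒳 → ℝ) : EReal :=
  let μ1 : 𝒳 → ℝ := fun a => ∑ b, μ (a, b)
  let μ2 : 𝒳 → ℝ := fun b => ∑ a, μ (a, b)
  if ∀ a, μ2 a = 0 → μ1 a = 0 then
    (relEnt μ (fun x => μ1 x.1 * Q x.1 x.2) : EReal)
      + ∑ a, (μ2 a : EReal) * cramerRate p (μ1 a / μ2 a)
  else ⊤

set_option linter.unusedSectionVars false

/-- A critical, non-degenerate offspring law with exponential moments of all orders. -/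
structure IsCriticalOffspring (p : ℕ → ℝ) : Prop where
  nonneg : ∀ n, 0 ≤ p n
  hasSum : HasSum p 1
  zero_pos : 0 < p 0
  mean : HasSum (fun n : ℕ => (n : ℝ) * p n) 1
  exists_two_le : ∃ k, 2 ≤ k ∧ 0 < p k
  summable_exp : ∀ lam : ℝ, Summable fun n : ℕ => p n * Real.exp (lam * n)

lemma summable_mul_exp_of_superexponential_tail {p : ℕ → ℝ} (hp : ∀ n, 0 ≤ p n)
    (htail : Tendsto (fun n : ℕ => (((n : ℝ)⁻¹ : ℝ) : EReal) * elog (ENNReal.ofReal (p n)))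
      atTop (nhds ⊥)) (lam : ℝ) :
    Summable fun n : ℕ => p n * Real.exp (lam * n) := by
  have hev := (tendsto_order.1 htail).2 ((-(lam + 1) : ℝ) : EReal) (EReal.bot_lt_coe _)
  refine Summable.of_norm_bounded_eventually_nat (g := fun n : ℕ => Real.exp (-(n : ℝ)))
    Real.summable_exp_neg_nat ?_
  filter_upwards [hev, eventually_gt_atTop 0] with n hn hn0
  rw [Real.norm_of_nonneg (mul_nonneg (hp n) (Real.exp_pos _).le)]
  rcases (hp n).eq_or_lt with h0 | h0
  · rw [← h0, zero_mul]; positivity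
  have hpos : (0 : ℝ) < n := Nat.cast_pos.2 hn0
  rw [elog, if_neg (by simpa using h0), if_neg ENNReal.ofReal_ne_top,
    ENNReal.toReal_ofReal h0.le, ← EReal.coe_mul, EReal.coe_lt_coe_iff] at hn
  have h1 : Real.log (p n) < -(lam + 1) * n := by
    rw [inv_mul_lt_iff₀ hpos] at hn
    linarith
  calc p n * Real.exp (lam * n) = Real.exp (Real.log (p n) + lam * n) := by
        rw [Real.exp_add, Real.exp_log h0]
    _ ≤ Real.exp (-(n : ℝ)) := Real.exp_le_exp.2 (by linarith)

lemma exists_two_le_of_zero_lt {p : ℕ → ℝ} (hp : ∀ n, 0 ≤ p n) (hsum : HasSum p 1)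
    (h01 : p 0 < 1 - p 1) : ∃ k, 2 ≤ k ∧ 0 < p k := by
  by_contra! h
  have hz : ∀ n ∉ Finset.range 2, p n = 0 := fun n hn =>
    le_antisymm (h n (by simp at hn; omega)) (hp n)
  have := (hasSum_sum_of_ne_finset_zero hz).unique hsum
  rw [Finset.sum_range_succ, Finset.sum_range_one] at this
  linarith

/-- The moment generating function of `p`. -/
noncomputable def offspringMgf (p : ℕ → ℝ) (lam : ℝ) : ℝ :=
  ∑' n : ℕ, p n * Real.exp (lam * n)

/-- The derivative of the moment generating function of `p`. -/
noncomputable def offspringMgfDeriv (p : ℕ → ℝ) (lam : ℝ) : ℝ :=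
  ∑' n : ℕ, p n * (n * Real.exp (lam * n))

namespace IsCriticalOffspring

variable {p : ℕ → ℝ}

lemma le_mgf (hp : IsCriticalOffspring p) (lam : ℝ) (k : ℕ) :
    p k * Real.exp (lam * k) ≤ offspringMgf p lam :=
  (hp.summable_exp lam).le_tsum k fun n _ => mul_nonneg (hp.nonneg n) (Real.exp_pos _).le

lemma mgf_pos (hp : IsCriticalOffspring p) (lam : ℝ) : 0 < offspringMgf p lam := by
  have := hp.le_mgf lam 0
  simp only [Nat.cast_zero, mul_zero, Real.exp_zero, mul_one] at this
  exact hp.zero_pos.trans_le this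

lemma mgf_zero (hp : IsCriticalOffspring p) : offspringMgf p 0 = 1 := by
  simp [offspringMgf, hp.hasSum.tsum_eq]

lemma summable_mul_exp (hp : IsCriticalOffspring p) (lam : ℝ) :
    Summable fun n : ℕ => p n * (n * Real.exp (lam * n)) := by
  refine Summable.of_nonneg_of_le
    (fun n => mul_nonneg (hp.nonneg n) (by positivity)) (fun n => ?_) (hp.summable_exp (lam + 1))
  refine mul_le_mul_of_nonneg_left ?_ (hp.nonneg n)
  rw [add_mul, Real.exp_add, one_mul, mul_comm]
  exact mul_le_mul_of_nonneg_left ((by linarith : (n : ℝ) ≤ n + 1).trans (Real.add_one_le_exp _))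
    (Real.exp_pos _).le

lemma hasDerivAt_mgf (hp : IsCriticalOffspring p) (lam : ℝ) :
    HasDerivAt (offspringMgf p) (offspringMgfDeriv p lam) lam := by
  refine hasDerivAt_tsum_of_isPreconnected (t := Set.Iio (lam + 1))
    (g := fun (n : ℕ) s => p n * Real.exp (s * n))
    (g' := fun (n : ℕ) s => p n * (n * Real.exp (s * n)))
    (u := fun n : ℕ => p n * (n * Real.exp ((lam + 1) * n))) (hp.summable_mul_exp _)
    isOpen_Iio isPreconnected_Iio (fun n y _ => ?_) (fun n y hy => ?_)
    (y₀ := lam) (by simp) (hp.summable_exp lam) (by simp)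
  · have h := ((hasDerivAt_id y).mul_const (n : ℝ)).exp.const_mul (p n)
    simpa [mul_comm] using h
  · rw [Real.norm_of_nonneg (mul_nonneg (hp.nonneg n) (by positivity))]
    have hy' : y ≤ lam + 1 := le_of_lt hy
    have := hp.nonneg n
    gcongr

lemma hasDerivAt_log_mgf (hp : IsCriticalOffspring p) (lam : ℝ) :
    HasDerivAt (fun s => Real.log (offspringMgf p s))
      (offspringMgfDeriv p lam / offspringMgf p lam) lam :=
  (hp.hasDerivAt_mgf lam).log (hp.mgf_pos lam).ne'

lemma le_log_mgf (hp : IsCriticalOffspring p) (lam : ℝ) :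
    lam ≤ Real.log (offspringMgf p lam) := by
  rw [Real.le_log_iff_exp_le (hp.mgf_pos lam)]
  have h1 : HasSum (fun n : ℕ => Real.exp lam * (1 - lam) * p n
      + Real.exp lam * lam * ((n : ℝ) * p n)) (Real.exp lam) := by
    have := (hp.hasSum.mul_left (Real.exp lam * (1 - lam))).add
      (hp.mean.mul_left (Real.exp lam * lam))
    rwa [show Real.exp lam * (1 - lam) * 1 + Real.exp lam * lam * 1 = Real.exp lam by ring] at this
  refine hasSum_le (fun n => ?_) h1 (hp.summable_exp lam).hasSum
  have h2 : Real.exp (lam * n) = Real.exp lam * Real.exp (lam * (n - 1)) := by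
    rw [← Real.exp_add]; ring_nf
  have h3 := Real.add_one_le_exp (lam * (n - 1))
  have h4 : 0 ≤ p n * Real.exp lam := mul_nonneg (hp.nonneg n) (Real.exp_pos _).le
  rw [h2]
  nlinarith [mul_le_mul_of_nonneg_left h3 h4]

/-- Every value strictly between `0` and a point charged by `p` is the mean of an exponential
tilt of `p`. -/
lemma exists_mgfDeriv_eq (hp : IsCriticalOffspring p) {x : ℝ} (hx : 0 < x) {k : ℕ}
    (hk : 0 < p k) (hxk : x < k) :
    ∃ lam, offspringMgfDeriv p lam = x * offspringMgf p lam := by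
  set f : ℝ → ℝ := fun s => Real.log (offspringMgf p s) - s * x with hf
  have hder : ∀ s, HasDerivAt f (offspringMgfDeriv p s / offspringMgf p s - 1 * x) s := fun s =>
    (hp.hasDerivAt_log_mgf s).sub ((hasDerivAt_id s).mul_const x)
  have hcont : Continuous f := continuous_iff_continuousAt.2 fun s => (hder s).continuousAt
  have hlow : ∀ (j : ℕ), 0 < p j → ∀ s, Real.log (p j) + s * (j - x) ≤ f s := by
    intro j hj s
    have := Real.log_le_log (by positivity) (hp.le_mgf s j)
    rw [Real.log_mul hj.ne' (Real.exp_pos _).ne', Real.log_exp] at this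
    simp only [hf]
    linarith
  have hcoer : Tendsto f (cocompact ℝ) atTop := by
    rw [cocompact_eq_atBot_atTop, tendsto_sup]
    constructor
    · refine tendsto_atTop_mono (hlow 0 hp.zero_pos) ?_
      refine tendsto_atTop_add_const_left _ _ ?_
      exact tendsto_id.atBot_mul_const_of_neg (by simpa using hx)
    · refine tendsto_atTop_mono (hlow k hk) ?_
      refine tendsto_atTop_add_const_left _ _ ?_
      exact tendsto_id.atTop_mul_const (by linarith)
  obtain ⟨s, hs⟩ := hcont.exists_forall_le hcoer
  have hmin : IsLocalMin f s := Filter.Eventually.of_forall hs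
  have h0 := hmin.hasDerivAt_eq_zero (hder s)
  refine ⟨s, ?_⟩
  have := hp.mgf_pos s
  field_simp at h0
  linarith

lemma cramerRate_nonneg (hp : IsCriticalOffspring p) (x : ℝ) : 0 ≤ cramerRate p x := by
  refine le_trans (le_of_eq ?_) (le_iSup _ (0 : ℝ))
  have := hp.mgf_zero
  rw [offspringMgf] at this
  rw [this]
  simp

lemma cramerRate_one (hp : IsCriticalOffspring p) : cramerRate p 1 ≤ 0 := by
  refine iSup_le fun lam => ?_
  have := hp.le_log_mgf lam
  rw [offspringMgf] at this
  exact_mod_cast (by linarith : lam * 1 - _ ≤ (0 : ℝ))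

lemma exists_le_of_cramerRate_ne_top (hp : IsCriticalOffspring p) {x : ℝ}
    (hx : cramerRate p x ≠ ⊤) : ∃ k, 0 < p k ∧ x ≤ k := by
  by_contra! h
  apply hx
  have hx0 : 0 < x := by simpa using h 0 hp.zero_pos
  obtain ⟨d, hd, hdk⟩ : ∃ d, 0 < d ∧ ∀ k, 0 < p k → (k : ℝ) ≤ x - d := by
    obtain ⟨N, hN⟩ := exists_nat_ge x
    set s := (Finset.range N).filter fun k => 0 < p k with hs
    have hmem : ∀ k, 0 < p k → k ∈ s := fun k hk => by
      have := (h k hk).trans_le hN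
      simp only [hs, Finset.mem_filter, Finset.mem_range]
      exact ⟨by exact_mod_cast this, hk⟩
    obtain ⟨k0, hk0, hmax⟩ := s.exists_max_image id ⟨0, hmem 0 hp.zero_pos⟩
    have hk0' : 0 < p k0 := (Finset.mem_filter.1 hk0).2
    refine ⟨x - k0, sub_pos.2 (h k0 hk0'), fun k hk => ?_⟩
    have : (k : ℝ) ≤ k0 := by exact_mod_cast hmax k (hmem k hk)
    linarith
  rw [EReal.eq_top_iff_forall_lt]
  intro y
  set lam := (|y| + 1) / d
  have hl : 0 < lam := by positivity
  have hM : offspringMgf p lam ≤ Real.exp (lam * (x - d)) := by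
    have h2 := hp.hasSum.mul_right (Real.exp (lam * (x - d)))
    rw [one_mul] at h2
    refine hasSum_le (fun n => ?_) (hp.summable_exp lam).hasSum h2
    rcases (hp.nonneg n).eq_or_lt with h0 | h0
    · simp [← h0]
    · have := hdk n h0
      gcongr
  have hlog : Real.log (offspringMgf p lam) ≤ lam * (x - d) := by
    have := Real.log_le_log (hp.mgf_pos lam) hM
    rwa [Real.log_exp] at this
  refine lt_of_lt_of_le ?_ (le_iSup _ lam)
  rw [EReal.coe_lt_coe_iff, ← offspringMgf]
  have : lam * d = |y| + 1 := by simp only [lam]; field_simp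
  nlinarith [le_abs_self y]

end IsCriticalOffspring

/-- An irreducible Markovian transition kernel. -/
structure IsIrreducibleKernel (Q : 𝒳 → 𝒳 → ℝ) : Prop where
  nonneg : ∀ a b, 0 ≤ Q a b
  sum_eq_one : ∀ a, ∑ b, Q a b = 1
  irreducible : ∀ a b, ∃ k : ℕ, 0 < ((Matrix.of Q) ^ (k + 1)) a b

/-- The logarithm of the mass of the kernel `Q` tilted by `g`. -/
noncomputable def logTilt (Q g : 𝒳 → 𝒳 → ℝ) (b : 𝒳) : ℝ :=
  Real.log (∑ c, Q b c * Real.exp (g b c))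

/-- The logarithmic normalisation of the offspring of a vertex of type `b` under the tilt `g`. -/
noncomputable def vertexCost (p : ℕ → ℝ) (Q g : 𝒳 → 𝒳 → ℝ) (b : 𝒳) : ℝ :=
  Real.log (offspringMgf p (logTilt Q g b))

/-- The linear functionals whose supremum is the rate function. -/
noncomputable def dualFn (p : ℕ → ℝ) (Q g : 𝒳 → 𝒳 → ℝ) (ν : 𝒳 × 𝒳 → ℝ) : ℝ :=
  ∑ x, ν x * (g x.1 x.2 - vertexCost p Q g x.2)

lemma EReal.coe_finset_sum' {ι : Type*} (s : Finset ι) (f : ι → ℝ) :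
    ((∑ i ∈ s, f i : ℝ) : EReal) = ∑ i ∈ s, (f i : EReal) := by
  classical
  induction s using Finset.induction_on with
  | empty => simp
  | insert a s ha ih => rw [Finset.sum_insert ha, Finset.sum_insert ha, EReal.coe_add, ih]

lemma EReal.iSup_coe_add_le {ι : Type*} {F : ι → ℝ} {b c : EReal}
    (h : ∀ i, (F i : EReal) + b ≤ c) : (⨆ i, (F i : EReal)) + b ≤ c := by
  refine EReal.add_le_of_forall_lt fun a' ha' b' hb' => ?_
  obtain ⟨i, hi⟩ := lt_iSup_iff.1 ha'
  exact (add_le_add hi.le hb'.le).trans (h i)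

lemma EReal.sum_iSup_coe_le {ι κ : Type*} [Nonempty κ] (s : Finset ι) {F : ι → κ → ℝ} {c : EReal}
    (h : ∀ k : ι → κ, ((∑ i ∈ s, F i (k i) : ℝ) : EReal) ≤ c) :
    ∑ i ∈ s, ⨆ k, (F i k : EReal) ≤ c := by
  classical
  induction s using Finset.induction_on generalizing c with
  | empty => simpa using h fun _ => Classical.arbitrary κ
  | insert a s ha ih =>
    rw [Finset.sum_insert ha]
    refine EReal.iSup_coe_add_le fun k0 => ?_
    rw [add_comm, ← EReal.le_sub_iff_add_le (by simp) (by simp)]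
    refine ih fun k => ?_
    rw [EReal.le_sub_iff_add_le (by simp) (by simp), ← EReal.coe_add]
    refine le_trans (le_of_eq ?_) (h (Function.update k a k0))
    rw [Finset.sum_insert ha, Function.update_self, add_comm]
    congr 2
    exact Finset.sum_congr rfl fun i hi => by
      rw [Function.update_of_ne (fun h : i = a => ha (h ▸ hi))]

lemma mul_log_div_le {x y h : ℝ} (hx : 0 ≤ x) (hy : 0 ≤ y) (hxy : y = 0 → x = 0) :
    x * h - x * Real.log (x / y) ≤ y * Real.exp h - x := by
  rcases hx.eq_or_lt with rfl | hx
  · simp only [zero_mul, sub_zero]; positivity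
  have hy : 0 < y := lt_of_le_of_ne hy fun h => hx.ne' (hxy h.symm)
  have h1 := Real.add_one_le_exp (h - Real.log (x / y))
  rw [Real.exp_sub, Real.exp_log (by positivity)] at h1
  have h2 := mul_le_mul_of_nonneg_left h1 hx.le
  have h3 : x * (Real.exp h / (x / y)) = y * Real.exp h := by field_simp
  linarith

lemma relEnt_of_ac {α : Type*} [Fintype α] {ν ρ : α → ℝ} (hν : ∀ a, 0 ≤ ν a) (hρ : ∀ a, 0 ≤ ρ a)
    (hac : ∀ a, ρ a = 0 → ν a = 0) (hsum : ∑ a, ν a = ∑ a, ρ a) :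
    (relEnt ν ρ : EReal) = ((∑ a, ν a * Real.log (ν a / ρ a) : ℝ) : EReal) := by
  have h1 : ∀ a, 0 ≤ ν a * Real.log (ν a / ρ a) + ρ a - ν a := fun a => by
    have := mul_log_div_le (h := 0) (hν a) (hρ a) (hac a)
    simp only [mul_zero, Real.exp_zero, mul_one] at this
    linarith
  have h2 : ∑ a, (ν a * Real.log (ν a / ρ a) + ρ a - ν a) =
      ∑ a, ν a * Real.log (ν a / ρ a) := by
    rw [Finset.sum_sub_distrib, Finset.sum_add_distrib, hsum]; ring
  rw [relEnt, if_pos hac, tsum_fintype, ← ENNReal.ofReal_sum_of_nonneg fun a _ => h1 a,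
    EReal.coe_ennreal_ofReal, max_eq_left (Finset.sum_nonneg fun a _ => h1 a), h2]

section Marginals

variable {Q : 𝒳 → 𝒳 → ℝ} {ν : 𝒳 × 𝒳 → ℝ}

lemma sum_prod_mul_fst (ν : 𝒳 × 𝒳 → ℝ) (u : 𝒳 → ℝ) :
    ∑ x, ν x * u x.1 = ∑ a, (∑ b, ν (a, b)) * u a := by
  rw [Fintype.sum_prod_type]
  simp_rw [Finset.sum_mul]

lemma sum_prod_mul_snd (ν : 𝒳 × 𝒳 → ℝ) (u : 𝒳 → ℝ) :
    ∑ x, ν x * u x.2 = ∑ b, (∑ a, ν (a, b)) * u b := by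
  rw [Fintype.sum_prod_type_right]
  simp_rw [Finset.sum_mul]

lemma sum_fst_mul (hQ : IsIrreducibleKernel Q) (hν : IsProbVec ν) :
    ∑ x : 𝒳 × 𝒳, (∑ b, ν (x.1, b)) * Q x.1 x.2 = 1 := by
  rw [Fintype.sum_prod_type]
  simp_rw [← Finset.mul_sum, hQ.sum_eq_one, mul_one]
  rw [← Fintype.sum_prod_type ν]
  exact hν.2

lemma IsProbVec.fst_nonneg (hν : IsProbVec ν) (a : 𝒳) : 0 ≤ ∑ b, ν (a, b) :=
  Finset.sum_nonneg fun _ _ => hν.1 _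

lemma IsProbVec.snd_nonneg (hν : IsProbVec ν) (b : 𝒳) : 0 ≤ ∑ a, ν (a, b) :=
  Finset.sum_nonneg fun _ _ => hν.1 _

lemma IsProbVec.eq_zero_of_fst (hν : IsProbVec ν) {a : 𝒳} (h : ∑ b, ν (a, b) = 0) (b : 𝒳) :
    ν (a, b) = 0 :=
  (Finset.sum_eq_zero_iff_of_nonneg fun _ _ => hν.1 _).1 h b (Finset.mem_univ b)

lemma IsIrreducibleKernel.tiltMass_pos (hQ : IsIrreducibleKernel Q) (g : 𝒳 → 𝒳 → ℝ) (b : 𝒳) :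
    0 < ∑ c, Q b c * Real.exp (g b c) := by
  refine (Finset.sum_nonneg fun c _ => mul_nonneg (hQ.nonneg b c) (Real.exp_pos _).le).lt_of_ne'
    fun h => ?_
  rw [Finset.sum_eq_zero_iff_of_nonneg
    fun c _ => mul_nonneg (hQ.nonneg b c) (Real.exp_pos _).le] at h
  have h1 := hQ.sum_eq_one b
  rw [Finset.sum_eq_zero fun c hc => ?_] at h1
  · exact zero_ne_one h1
  · simpa [(Real.exp_pos _).ne'] using h c hc

lemma IsIrreducibleKernel.exp_logTilt (hQ : IsIrreducibleKernel Q) (g : 𝒳 → 𝒳 → ℝ) (b : 𝒳) :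
    Real.exp (logTilt Q g b) = ∑ c, Q b c * Real.exp (g b c) :=
  Real.exp_log (hQ.tiltMass_pos g b)

lemma logTilt_sub_add (hQ : IsIrreducibleKernel Q) (f : 𝒳 → 𝒳 → ℝ) (lam : 𝒳 → ℝ) (b : 𝒳) :
    logTilt Q (fun b c => f b c - logTilt Q f b + lam b) b = lam b := by
  have h : ∀ c, Q b c * Real.exp (f b c - logTilt Q f b + lam b) =
      Q b c * Real.exp (f b c) * (Real.exp (lam b) / Real.exp (logTilt Q f b)) := fun c => by
    rw [Real.exp_add, Real.exp_sub]; ring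
  rw [logTilt]
  simp_rw [h]
  rw [← Finset.sum_mul, ← hQ.exp_logTilt f b, mul_div_cancel₀ _ (Real.exp_pos _).ne', Real.log_exp]

lemma logTilt_zero (hQ : IsIrreducibleKernel Q) (b : 𝒳) : logTilt Q 0 b = 0 := by
  simp [logTilt, hQ.sum_eq_one]

lemma dualFn_eq (p : ℕ → ℝ) (Q g : 𝒳 → 𝒳 → ℝ) (ν : 𝒳 × 𝒳 → ℝ) :
    dualFn p Q g ν = ∑ x, ν x * (g x.1 x.2 - logTilt Q g x.1) +
      ∑ a, ((∑ b, ν (a, b)) * logTilt Q g a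
        - (∑ b, ν (b, a)) * Real.log (offspringMgf p (logTilt Q g a))) := by
  rw [Finset.sum_sub_distrib, ← sum_prod_mul_fst, ← sum_prod_mul_snd, ← Finset.sum_sub_distrib,
    ← Finset.sum_add_distrib]
  refine Finset.sum_congr rfl fun x _ => ?_
  rw [vertexCost]
  ring

lemma continuous_dualFn (p : ℕ → ℝ) (Q g : 𝒳 → 𝒳 → ℝ) : Continuous (dualFn p Q g) := by
  unfold dualFn
  fun_prop

lemma entropy_le_iSup (hQ : IsIrreducibleKernel Q) (hν : IsProbVec ν) :
    (relEnt ν (fun x => (∑ b, ν (x.1, b)) * Q x.1 x.2) : EReal) ≤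
      ⨆ f : 𝒳 → 𝒳 → ℝ, ((∑ x, ν x * (f x.1 x.2 - logTilt Q f x.1) : ℝ) : EReal) := by
  by_cases hac : ∀ x : 𝒳 × 𝒳, (∑ b, ν (x.1, b)) * Q x.1 x.2 = 0 → ν x = 0
  · rw [relEnt_of_ac hν.1 (fun x => mul_nonneg (hν.fst_nonneg _) (hQ.nonneg _ _)) hac
      (by rw [sum_fst_mul hQ hν, hν.2])]
    refine EReal.le_of_forall_lt_iff_le.1 fun z hz => ?_
    rw [EReal.coe_le_coe_iff]
    refine le_of_forall_pos_le_add fun ε hε => ?_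
    set f : 𝒳 → 𝒳 → ℝ := fun a b => Real.log (ν (a, b) / ((∑ b, ν (a, b)) * Q a b) + ε) with hf
    have hq : ∀ a b, 0 ≤ ν (a, b) / ((∑ b, ν (a, b)) * Q a b) := fun a b =>
      div_nonneg (hν.1 _) (mul_nonneg (hν.fst_nonneg _) (hQ.nonneg _ _))
    have hU : ∀ a, 0 < ∑ b, ν (a, b) → logTilt Q f a ≤ ε := fun a ha => by
      have : ∑ b, Q a b * Real.exp (f a b) = 1 + ε := by
        have h1 : ∀ b, Q a b * Real.exp (f a b) = ν (a, b) / (∑ b, ν (a, b)) + ε * Q a b := by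
          intro b
          rw [hf, Real.exp_log (by have := hq a b; positivity)]
          rcases eq_or_ne (Q a b) 0 with h0 | h0
          · rw [hac (a, b) (by simp [h0])]; simp [h0]
          · field_simp
        simp_rw [h1]
        rw [Finset.sum_add_distrib, ← Finset.sum_div, div_self ha.ne', ← Finset.mul_sum,
          hQ.sum_eq_one, mul_one]
      rw [logTilt, this]
      linarith [Real.log_le_sub_one_of_pos (by linarith : 0 < 1 + ε)]
    have hle := (EReal.coe_lt_coe_iff.1 ((le_iSup _ f).trans_lt hz)).le
    have : ∑ x, ν x * Real.log (ν x / ((∑ b, ν (x.1, b)) * Q x.1 x.2)) - ε ≤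
        ∑ x, ν x * (f x.1 x.2 - logTilt Q f x.1) := by
      have h2 : ε = ∑ x, ν x * ε := by rw [← Finset.sum_mul, hν.2, one_mul]
      conv_lhs => rw [h2]
      rw [← Finset.sum_sub_distrib]
      refine Finset.sum_le_sum fun x _ => ?_
      rcases (hν.1 x).eq_or_lt with h0 | h0
      · simp [← h0]
      have hpos : 0 < (∑ b, ν (x.1, b)) * Q x.1 x.2 :=
        lt_of_le_of_ne (mul_nonneg (hν.fst_nonneg _) (hQ.nonneg _ _))
          fun h => h0.ne' (hac x h.symm)
      have h3 := hU x.1 (pos_of_mul_pos_left hpos (hQ.nonneg _ _))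
      have h4 : Real.log (ν x / ((∑ b, ν (x.1, b)) * Q x.1 x.2)) ≤ f x.1 x.2 :=
        Real.log_le_log (by positivity) (by simp only [Prod.mk.eta]; linarith)
      nlinarith
    linarith
  · push Not at hac
    obtain ⟨⟨a, b⟩, h0, h1⟩ := hac
    have hpos : 0 < ν (a, b) := lt_of_le_of_ne (hν.1 _) h1.symm
    have hQ0 : Q a b = 0 := by
      rcases mul_eq_zero.1 h0 with h | h
      · exact absurd (hν.eq_zero_of_fst h b) h1
      · exact h
    refine le_trans le_top (le_of_eq (Eq.symm ?_))
    rw [EReal.eq_top_iff_forall_lt]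
    intro y
    set s := (|y| + 1) / ν (a, b)
    set f : 𝒳 → 𝒳 → ℝ := fun a' b' => if a' = a ∧ b' = b then s else 0 with hf
    refine lt_of_lt_of_le ?_ (le_iSup _ f)
    have hU : ∀ c, logTilt Q f c = 0 := fun c => by
      have : ∑ d, Q c d * Real.exp (f c d) = 1 := by
        rw [← hQ.sum_eq_one c]
        refine Finset.sum_congr rfl fun d _ => ?_
        by_cases h : c = a ∧ d = b
        · obtain ⟨rfl, rfl⟩ := h
          simp [hQ0]
        · simp [hf, h]
      rw [logTilt, this, Real.log_one]
    rw [EReal.coe_lt_coe_iff]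
    have : ∑ x, ν x * (f x.1 x.2 - logTilt Q f x.1) = |y| + 1 := by
      simp_rw [hU, sub_zero]
      rw [Fintype.sum_eq_single (a, b) fun x hx => ?_]
      · simp only [hf, and_self, if_true, s]
        field_simp
      · have : ¬(x.1 = a ∧ x.2 = b) := fun h => hx (Prod.ext h.1 h.2)
        simp [hf, this]
    rw [this]
    linarith [le_abs_self y]

lemma perspective_le_iSup (p : ℕ → ℝ) {x y : ℝ} (hy : 0 ≤ y) (hxy : y = 0 → x = 0) :
    (y : EReal) * cramerRate p (x / y) ≤
      ⨆ lam : ℝ, ((x * lam - y * Real.log (offspringMgf p lam) : ℝ) : EReal) := by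
  rcases hy.eq_or_lt with rfl | hy
  · simp [hxy rfl]
  rw [mul_comm, ← EReal.le_div_iff_mul_le (by exact_mod_cast hy) (by simp)]
  refine iSup_le fun lam => ?_
  rw [EReal.le_div_iff_mul_le (by exact_mod_cast hy) (by simp), ← EReal.coe_mul]
  refine le_trans (le_of_eq ?_) (le_iSup _ lam)
  rw [← offspringMgf]
  congr 1
  field_simp

lemma le_perspective (p : ℕ → ℝ) {x y : ℝ} (hy : 0 ≤ y) (hxy : y = 0 → x = 0) (lam : ℝ) :
    ((x * lam - y * Real.log (offspringMgf p lam) : ℝ) : EReal) ≤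
      (y : EReal) * cramerRate p (x / y) := by
  rcases hy.eq_or_lt with rfl | hy
  · simp [hxy rfl]
  have h1 : ((lam * (x / y) - Real.log (offspringMgf p lam) : ℝ) : EReal) ≤
      cramerRate p (x / y) :=
    le_iSup (fun lam : ℝ => ((lam * (x / y) - Real.log (offspringMgf p lam) : ℝ) : EReal)) lam
  refine le_trans (le_of_eq ?_)
    (mul_le_mul_of_nonneg_left h1 (by exact_mod_cast hy.le : (0 : EReal) ≤ (y : EReal)))
  rw [← EReal.coe_mul]
  congr 1
  field_simp

lemma le_entropy (hQ : IsIrreducibleKernel Q) (hν : IsProbVec ν) (f : 𝒳 → 𝒳 → ℝ) :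
    ((∑ x, ν x * (f x.1 x.2 - logTilt Q f x.1) : ℝ) : EReal) ≤
      (relEnt ν (fun x => (∑ b, ν (x.1, b)) * Q x.1 x.2) : EReal) := by
  by_cases hac : ∀ x : 𝒳 × 𝒳, (∑ b, ν (x.1, b)) * Q x.1 x.2 = 0 → ν x = 0
  · have hρ : ∀ x : 𝒳 × 𝒳, 0 ≤ (∑ b, ν (x.1, b)) * Q x.1 x.2 := fun x =>
      mul_nonneg (hν.fst_nonneg _) (hQ.nonneg _ _)
    rw [relEnt_of_ac hν.1 hρ hac (by rw [sum_fst_mul hQ hν, hν.2]), EReal.coe_le_coe_iff,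
      ← sub_nonpos, ← Finset.sum_sub_distrib]
    refine (Finset.sum_le_sum fun x _ => mul_log_div_le (hν.1 x) (hρ x) (hac x)).trans ?_
    rw [Finset.sum_sub_distrib, hν.2, Fintype.sum_prod_type]
    have h1 : ∀ a, ∑ b, (∑ b, ν (a, b)) * Q a b * Real.exp (f a b - logTilt Q f a) =
        ∑ b, ν (a, b) := fun a => by
      have h : ∀ b, (∑ b, ν (a, b)) * Q a b * Real.exp (f a b - logTilt Q f a) =
          (∑ b, ν (a, b)) / Real.exp (logTilt Q f a) * (Q a b * Real.exp (f a b)) := fun b => by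
        rw [Real.exp_sub]; ring
      simp_rw [h]
      rw [← Finset.mul_sum, ← hQ.exp_logTilt f a, div_mul_cancel₀ _ (Real.exp_pos _).ne']
    simp_rw [h1]
    rw [← Fintype.sum_prod_type ν, hν.2, sub_self]
  · rw [relEnt, if_neg hac]
    exact le_top

lemma dualFn_le_rate (p : ℕ → ℝ) (hQ : IsIrreducibleKernel Q) (hν : IsProbVec ν)
    (g : 𝒳 → 𝒳 → ℝ) : (dualFn p Q g ν : EReal) ≤ rateGWPair p Q ν := by
  simp only [rateGWPair]
  split_ifs with h
  · rw [dualFn_eq, EReal.coe_add, EReal.coe_finset_sum' _ fun a => _ - _]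
    exact add_le_add (le_entropy hQ hν g)
      (Finset.sum_le_sum fun a _ => le_perspective p (hν.snd_nonneg a) (h a) _)
  · exact le_top

lemma rate_le_iSup_dualFn {p : ℕ → ℝ} (hp : IsCriticalOffspring p) (hQ : IsIrreducibleKernel Q)
    (hν : IsProbVec ν) :
    rateGWPair p Q ν ≤ ⨆ g : 𝒳 → 𝒳 → ℝ, (dualFn p Q g ν : EReal) := by
  simp only [rateGWPair]
  split_ifs with h
  · refine (add_le_add (entropy_le_iSup hQ hν) (Finset.sum_le_sum fun a _ =>
      perspective_le_iSup p (hν.snd_nonneg a) (h a))).trans ?_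
    refine EReal.iSup_coe_add_le fun f => ?_
    rw [add_comm, ← EReal.le_sub_iff_add_le (by simp) (by simp)]
    refine EReal.sum_iSup_coe_le _ fun lam => ?_
    rw [EReal.le_sub_iff_add_le (by simp) (by simp), ← EReal.coe_add]
    refine le_trans (le_of_eq ?_) (le_iSup _ fun b c => f b c - logTilt Q f b + lam b)
    rw [dualFn_eq, add_comm]
    simp_rw [logTilt_sub_add hQ, add_sub_cancel_right]
  · push Not at h
    obtain ⟨a, h2, h1⟩ := h
    have hpos : 0 < ∑ b, ν (a, b) := lt_of_le_of_ne (hν.fst_nonneg a) h1.symm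
    refine le_of_eq (Eq.symm ?_)
    rw [EReal.eq_top_iff_forall_lt]
    intro y
    set s := (|y| + 1) / ∑ b, ν (a, b) with hs
    have hU := logTilt_sub_add hQ 0 fun b => if b = a then s else 0
    refine lt_of_lt_of_le ?_
      (le_iSup _ fun b c => (0 : 𝒳 → 𝒳 → ℝ) b c - logTilt Q 0 b + if b = a then s else 0)
    rw [dualFn_eq, EReal.coe_lt_coe_iff]
    simp_rw [hU]
    have h3 : ∀ b, ((∑ c, ν (b, c)) * (if b = a then s else 0)
        - (∑ c, ν (c, b)) * Real.log (offspringMgf p (if b = a then s else 0))) =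
        if b = a then |y| + 1 else 0 := fun b => by
      split_ifs with hb
      · subst hb
        rw [h2, hs]
        field_simp
        simp
      · simp [hp.mgf_zero]
    simp_rw [h3]
    simp [logTilt_zero hQ]
    linarith [le_abs_self y]

lemma rate_eq_iSup_dualFn {p : ℕ → ℝ} (hp : IsCriticalOffspring p) (hQ : IsIrreducibleKernel Q)
    (hν : IsProbVec ν) :
    rateGWPair p Q ν = ⨆ g : 𝒳 → 𝒳 → ℝ, (dualFn p Q g ν : EReal) :=
  (rate_le_iSup_dualFn hp hQ hν).antisymm (iSup_le fun g => dualFn_le_rate p hQ hν g)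

end Marginals

namespace ENNReal

lemma tsum_le_tsum_of_injOn {α β : Type*} {f : α → ℝ≥0∞} {g : β → ℝ≥0∞} {i : α → β} (s : Set α)
    (hi : Set.InjOn i s) (hf : ∀ x, x ∉ s → f x = 0) (hle : ∀ x ∈ s, f x ≤ g (i x)) :
    ∑' x, f x ≤ ∑' y, g y := by
  have h1 : ∑' x, f x = ∑' x : s, f x :=
    (tsum_subtype_eq_of_support_subset fun x hx => by_contra fun h => hx (hf x h)).symm
  rw [h1]
  refine (ENNReal.tsum_le_tsum fun x : s => hle x x.2).trans ?_
  exact ENNReal.tsum_comp_le_tsum_of_injective hi.injective g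

lemma tsum_mul_comp {α β : Type*} [DecidableEq β] (r : α → β) (f : α → ℝ≥0∞) (H : β → ℝ≥0∞) :
    ∑' a, f a * H (r a) = ∑' b, (∑' a, if r a = b then f a else 0) * H b := by
  simp_rw [← ENNReal.tsum_mul_right]
  rw [ENNReal.tsum_comm]
  refine tsum_congr fun a => ?_
  rw [tsum_eq_single (r a) fun b hb => by rw [if_neg hb.symm, zero_mul], if_pos rfl]

lemma tsum_list {α : Type*} (f : List α → ℝ≥0∞) :
    ∑' l, f l = f [] + ∑' a, ∑' l, f (a :: l) := by
  classical
  rw [ENNReal.tsum_eq_add_tsum_ite []]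
  congr 1
  have hinj : Function.Injective fun x : α × List α => x.1 :: x.2 := fun x y h => by
    simpa [Prod.ext_iff] using h
  rw [← ENNReal.tsum_prod (f := fun a l => f (a :: l)), ← hinj.tsum_eq]
  · exact tsum_congr fun x => by simp
  · intro l hl
    cases l with
    | nil => simp at hl
    | cons a l => exact ⟨(a, l), rfl⟩

lemma tsum_list_length {α : Type*} (f : List α → ℝ≥0∞) :
    ∑' l, f l = ∑' k : ℕ, ∑' l : List α, if l.length = k then f l else 0 := by
  rw [ENNReal.tsum_comm]
  exact tsum_congr fun l => (tsum_ite_eq' l.length fun _ => f l).symm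

lemma tsum_list_zero {α : Type*} (f : List α → ℝ≥0∞) :
    ∑' l : List α, (if l.length = 0 then f l else 0) = f [] := by
  rw [tsum_list]; simp

lemma tsum_list_succ {α : Type*} (f : List α → ℝ≥0∞) (k : ℕ) :
    ∑' l : List α, (if l.length = k + 1 then f l else 0) =
      ∑' a, ∑' l : List α, if l.length = k then f (a :: l) else 0 := by
  rw [tsum_list]; simp

lemma tsum_list_map {α β : Type*} [DecidableEq β] (r : α → β) (w : α → ℝ≥0∞)
    (G : List β → ℝ≥0∞) :
    ∑' l : List α, G (l.map r) * (l.map w).prod =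
      ∑' l : List β, G l * (l.map fun b => ∑' a, if r a = b then w a else 0).prod := by
  rw [tsum_list_length, tsum_list_length (fun l : List β => _)]
  refine tsum_congr fun k => ?_
  induction k generalizing G with
  | zero => rw [tsum_list_zero, tsum_list_zero]; simp
  | succ k ih =>
    rw [tsum_list_succ, tsum_list_succ]
    have h1 : ∀ a, ∑' l : List α, (if l.length = k
        then G ((a :: l).map r) * ((a :: l).map w).prod else 0) =
        w a * ∑' l : List β, if l.length = k
          then G (r a :: l) * (l.map fun b => ∑' a, if r a = b then w a else 0).prod else 0 := by
      intro a
      rw [← ih fun l => G (r a :: l), ← ENNReal.tsum_mul_left]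
      refine tsum_congr fun l => ?_
      rw [List.map_cons, List.map_cons, List.prod_cons, mul_ite, mul_zero]
      congr 1
      ring
    simp_rw [h1]
    rw [tsum_mul_comp r w fun b => ∑' l : List β, if l.length = k
      then G (b :: l) * (l.map fun b => ∑' a, if r a = b then w a else 0).prod else 0]
    refine tsum_congr fun b => ?_
    rw [← ENNReal.tsum_mul_left]
    refine tsum_congr fun l => ?_
    rw [List.map_cons, List.prod_cons, mul_ite, mul_zero]
    congr 1
    ring

lemma tsum_list_insert {β : Type*} [DecidableEq β] (F : List β → ℝ≥0∞) (c : β) :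
    ∑' l₁ : List β, ∑' l₂ : List β, F (l₁ ++ c :: l₂) = ∑' l, F l * (l.count c : ℝ≥0∞) := by
  have key : ∀ (k : ℕ) (F : List β → ℝ≥0∞),
      ∑' l₁ : List β, ∑' l₂ : List β, (if (l₁ ++ c :: l₂).length = k then F (l₁ ++ c :: l₂) else 0)
        = ∑' l, if l.length = k then F l * (l.count c : ℝ≥0∞) else 0 := by
    intro k
    induction k with
    | zero => intro F; rw [tsum_list_zero]; simp
    | succ k ih =>
      intro F
      rw [tsum_list_succ, tsum_list]
      have h1 : ∀ a l₁, ∑' l₂ : List β, (if (a :: l₁ ++ c :: l₂).length = k + 1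
          then F (a :: l₁ ++ c :: l₂) else 0) =
          ∑' l₂ : List β, if (l₁ ++ c :: l₂).length = k then F (a :: (l₁ ++ c :: l₂)) else 0 := by
        intro a l₁
        refine tsum_congr fun l₂ => ?_
        simp only [List.cons_append, List.length_cons, Nat.add_right_cancel_iff]
      have h1' : ∀ a, ∑' l₁ : List β, ∑' l₂ : List β, (if (l₁ ++ c :: l₂).length = k
          then F (a :: (l₁ ++ c :: l₂)) else 0) = _ := fun a => ih fun l => F (a :: l)
      simp_rw [h1, h1']
      have h2 : ∀ a, ∑' l : List β, (if l.length = k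
          then F (a :: l) * ((a :: l).count c : ℝ≥0∞) else 0) =
          ∑' l : List β, (if l.length = k then F (a :: l) * (l.count c : ℝ≥0∞) else 0) +
          if a = c then ∑' l : List β, (if l.length = k then F (a :: l) else 0) else 0 := by
        intro a
        split_ifs with hac
        · subst hac
          rw [← ENNReal.tsum_add]
          refine tsum_congr fun l => ?_
          rw [List.count_cons_self]
          split_ifs
          · push_cast; ring
          · simp
        · simp [List.count_cons_of_ne hac]
      simp_rw [h2]
      rw [ENNReal.tsum_add, tsum_ite_eq, add_comm]
      simp
  calc ∑' l₁ : List β, ∑' l₂ : List β, F (l₁ ++ c :: l₂)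
      = ∑' l₁ : List β, ∑' l₂ : List β, ∑' k : ℕ,
          if (l₁ ++ c :: l₂).length = k then F (l₁ ++ c :: l₂) else 0 :=
        tsum_congr fun l₁ => tsum_congr fun l₂ => (tsum_ite_eq' _ fun _ => F (l₁ ++ c :: l₂)).symm
    _ = ∑' l₁ : List β, ∑' k : ℕ, ∑' l₂ : List β,
          if (l₁ ++ c :: l₂).length = k then F (l₁ ++ c :: l₂) else 0 :=
        tsum_congr fun l₁ => ENNReal.tsum_comm
    _ = ∑' k : ℕ, ∑' l, if l.length = k then F l * (l.count c : ℝ≥0∞) else 0 := by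
        rw [ENNReal.tsum_comm]
        exact tsum_congr fun k => key k F
    _ = _ := (tsum_list_length _).symm

end ENNReal

namespace PTree

lemma induction_on {P : PTree 𝒳 → Prop} (t : PTree 𝒳)
    (h : ∀ a ts, (∀ s ∈ ts, P s) → P (node a ts)) : P t := by
  induction hn : sizeOf t using Nat.strong_induction_on generalizing t with
  | _ n ih =>
    obtain ⟨a, ts⟩ := t
    refine h a ts fun s hs => ih (sizeOf s) ?_ s rfl
    have := List.sizeOf_lt_of_mem hs
    rw [← hn, PTree.node.sizeOf_spec]
    omega

lemma subtrees_node (a : 𝒳) (ts : List (PTree 𝒳)) :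
    subtrees (node a ts) = node a ts :: (ts.map subtrees).flatten := by
  rw [subtrees, List.attach_map_val]

lemma sum_map_subtrees {M : Type*} [AddCommMonoid M] (f : PTree 𝒳 → M) (a : 𝒳)
    (ts : List (PTree 𝒳)) :
    ((subtrees (node a ts)).map f).sum =
      f (node a ts) + (ts.map fun t => (t.subtrees.map f).sum).sum := by
  rw [subtrees_node, List.map_cons, List.sum_cons, List.map_flatten, List.sum_flatten, List.map_map,
    List.map_map]
  rfl

lemma size_node (a : 𝒳) (ts : List (PTree 𝒳)) :
    size (node a ts) = 1 + (ts.map size).sum := by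
  have h : ∀ t : PTree 𝒳, size t = (t.subtrees.map fun _ => 1).sum := fun t => by
    simp [size]
  rw [h, sum_map_subtrees]
  congr 2
  exact List.map_congr_left fun t _ => (h t).symm

lemma size_pos (t : PTree 𝒳) : 0 < t.size := by
  obtain ⟨a, ts⟩ := t
  rw [size_node]; omega

lemma pairCount_node (a : 𝒳) (ts : List (PTree 𝒳)) (b c : 𝒳) :
    pairCount (node a ts) b c =
      (if a = b then (ts.map root).count c else 0) + (ts.map fun t => pairCount t b c).sum := by
  rw [pairCount, sum_map_subtrees]
  rfl

lemma root_eta (t : PTree 𝒳) : node t.root t.children = t := by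
  cases t; rfl

/-- The weight `∏_v K(X(v), types of the children of v)` of a typed tree. -/
noncomputable def weight (K : 𝒳 → List 𝒳 → ℝ≥0∞) (t : PTree 𝒳) : ℝ≥0∞ :=
  (t.subtrees.map fun s => K s.root s.childLabels).prod

lemma weight_node (K : 𝒳 → List 𝒳 → ℝ≥0∞) (a : 𝒳) (ts : List (PTree 𝒳)) :
    weight K (node a ts) = K a (ts.map root) * (ts.map (weight K)).prod := by
  rw [weight, subtrees_node, List.map_cons, List.prod_cons, List.map_flatten, List.prod_flatten,
    List.map_map, List.map_map]
  rfl

lemma tsum_eq_tsum_node (f : PTree 𝒳 → ℝ≥0∞) : ∑' t, f t = ∑' a, ∑' ts, f (node a ts) := by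
  let e : 𝒳 × List (PTree 𝒳) ≃ PTree 𝒳 :=
    { toFun := fun x => node x.1 x.2
      invFun := fun t => (t.root, t.children)
      left_inv := fun _ => rfl
      right_inv := root_eta }
  rw [← e.tsum_eq, ENNReal.tsum_prod']
  rfl

/-- The total weight of the finite trees with root of type `b`. -/
noncomputable def mass (K : 𝒳 → List 𝒳 → ℝ≥0∞) (b : 𝒳) : ℝ≥0∞ :=
  ∑' t : PTree 𝒳, if t.root = b then weight K t else 0

lemma tsum_root_eq (f : PTree 𝒳 → ℝ≥0∞) (b : 𝒳) :
    ∑' t : PTree 𝒳, (if t.root = b then f t else 0) = ∑' ts, f (node b ts) := by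
  rw [tsum_eq_tsum_node]
  rw [tsum_eq_single b fun a ha => by simp [root, ha]]
  simp [root]

lemma tsum_forest (K : 𝒳 → List 𝒳 → ℝ≥0∞) (G : List 𝒳 → ℝ≥0∞) :
    ∑' ts : List (PTree 𝒳), G (ts.map root) * (ts.map (weight K)).prod =
      ∑' l : List 𝒳, G l * (l.map (mass K)).prod :=
  ENNReal.tsum_list_map root (weight K) G

lemma mass_eq (K : 𝒳 → List 𝒳 → ℝ≥0∞) (b : 𝒳) :
    mass K b = ∑' l : List 𝒳, K b l * (l.map (mass K)).prod := by
  rw [mass, tsum_root_eq]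
  simp_rw [weight_node]
  exact tsum_forest K (K b)

lemma list_prod_le_one (l : List ℝ≥0∞) (h : ∀ x ∈ l, x ≤ 1) : l.prod ≤ 1 := by
  induction l with
  | nil => simp
  | cons x l ih =>
    rw [List.prod_cons]
    exact mul_le_one' (h x (by simp)) (ih fun y hy => h y (by simp [hy]))

lemma mass_le_one {K : 𝒳 → List 𝒳 → ℝ≥0∞} (hK : ∀ b, ∑' l, K b l ≤ 1) (b : 𝒳) :
    mass K b ≤ 1 := by
  have hN : ∀ N b, ∑' t : PTree 𝒳, (if t.root = b then
      (if t.size ≤ N then weight K t else 0) else 0) ≤ 1 := by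
    intro N
    induction N with
    | zero =>
      intro b
      simp [fun t : PTree 𝒳 => (size_pos t).ne']
    | succ N ih =>
      intro b
      rw [tsum_root_eq fun t => if t.size ≤ N + 1 then weight K t else 0]
      calc ∑' ts : List (PTree 𝒳),
            (if (node b ts).size ≤ N + 1 then weight K (node b ts) else 0)
          ≤ ∑' ts : List (PTree 𝒳), K b (ts.map root) *
              (ts.map fun t => if t.size ≤ N then weight K t else 0).prod := by
            refine ENNReal.tsum_le_tsum fun ts => ?_
            split_ifs with h
            · rw [weight_node]
              refine le_of_eq ?_
              congr 2
              refine List.map_congr_left fun t ht => ?_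
              rw [size_node] at h
              have := List.single_le_sum (fun _ _ => Nat.zero_le _) _ (List.mem_map_of_mem (f := size) ht)
              rw [if_pos (by omega)]
            · exact zero_le
        _ = ∑' l : List 𝒳, K b l * (l.map fun c => ∑' t : PTree 𝒳, if t.root = c then
              (if t.size ≤ N then weight K t else 0) else 0).prod :=
            ENNReal.tsum_list_map root _ (K b)
        _ ≤ ∑' l : List 𝒳, K b l := by
            refine ENNReal.tsum_le_tsum fun l => mul_le_of_le_one_right' ?_
            refine list_prod_le_one _ fun x hx => ?_
            obtain ⟨c, -, rfl⟩ := List.mem_map.1 hx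
            exact ih c
        _ ≤ 1 := hK b
  rw [mass, ENNReal.tsum_eq_iSup_sum]
  refine iSup_le fun s => ?_
  refine le_trans (le_trans (Finset.sum_le_sum fun t ht => ?_) (ENNReal.sum_le_tsum s))
    (hN (s.sup size) b)
  rw [if_pos (Finset.le_sup (f := size) ht)]

lemma tsum_weight_le {K : 𝒳 → List 𝒳 → ℝ≥0∞} (hK : ∀ b, ∑' l, K b l ≤ 1) :
    ∑' t, weight K t ≤ Fintype.card 𝒳 := by
  have h1 : ∑' t, weight K t = ∑ b, mass K b := by
    have := ENNReal.tsum_mul_comp (root (𝒳 := 𝒳)) (weight K) fun _ => 1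
    simp only [mul_one] at this
    rw [this, tsum_fintype]
    rfl
  rw [h1]
  refine (Finset.sum_le_sum fun b _ => mass_le_one hK b).trans ?_
  simp

/-- The mean offspring matrix of the kernel `K`. -/
noncomputable def meanMatrix (K : 𝒳 → List 𝒳 → ℝ≥0∞) : Matrix 𝒳 𝒳 ℝ≥0∞ :=
  Matrix.of fun b c => ∑' l, K b l * (l.count c : ℝ≥0∞)

lemma one_le_prod_add_sum_one_sub (l : List ℝ≥0∞) (h : ∀ x ∈ l, x ≤ 1) :
    1 ≤ l.prod + (l.map fun x => 1 - x).sum := by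
  induction l with
  | nil => simp
  | cons x l ih =>
    have hx := h x (by simp)
    have h1 := ih fun y hy => h y (by simp [hy])
    rw [List.prod_cons, List.map_cons, List.sum_cons]
    calc (1 : ℝ≥0∞) = x * 1 + (1 - x) := by rw [mul_one, add_tsub_cancel_of_le hx]
      _ ≤ x * (l.prod + (l.map fun x => 1 - x).sum) + (1 - x) := by gcongr
      _ ≤ x * l.prod + (l.map fun x => 1 - x).sum + (1 - x) := by
          rw [mul_add]; gcongr; exact mul_le_of_le_one_left' hx
      _ = _ := by ring

lemma eq_one_of_pow_add_eq_one {x : ℝ≥0∞} (hx : x ≤ 1) {k : ℕ} (hk : 2 ≤ k)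
    (h : x ^ k + k * (1 - x) = 1) : x = 1 := by
  lift x to ℝ≥0 using ne_top_of_le_ne_top ENNReal.one_ne_top hx
  have hx1 : x ≤ 1 := by exact_mod_cast hx
  have h2 : (x : ℝ) ^ k + k * (1 - x) = 1 := by
    have h3 : x ^ k + k * (1 - x) = 1 := by exact_mod_cast h
    have := congrArg NNReal.toReal h3
    rwa [NNReal.coe_add, NNReal.coe_pow, NNReal.coe_mul, NNReal.coe_sub hx1, NNReal.coe_natCast,
      NNReal.coe_one] at this
  have hx1' : (x : ℝ) ≤ 1 := by exact_mod_cast hx1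
  by_contra hne
  have hlt : (x : ℝ) < 1 := lt_of_le_of_ne hx1' fun h => hne (by exact_mod_cast h)
  obtain ⟨j, rfl⟩ : ∃ j, k = j + 2 := ⟨k - 2, by omega⟩
  have hb := one_add_mul_le_pow (a := (x : ℝ) - 1) (by linarith [x.2]) j
  rw [add_sub_cancel] at hb
  have h0 : (0 : ℝ) ≤ j := Nat.cast_nonneg j
  have h4 : (1 + j * ((x : ℝ) - 1)) * x ^ 2 ≤ x ^ (j + 2) := by
    rw [pow_add]; exact mul_le_mul_of_nonneg_right hb (sq_nonneg _)
  push_cast at h2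
  have hx0 : (0 : ℝ) ≤ x := x.2
  nlinarith [mul_pos (sub_pos.2 hlt) (sub_pos.2 hlt),
    mul_nonneg h0 (mul_nonneg (sub_pos.2 hlt).le (by nlinarith : (0 : ℝ) ≤ 1 - x ^ 2))]

lemma sum_map_eq_sum_count (l : List 𝒳) (f : 𝒳 → ℝ≥0∞) :
    (l.map f).sum = ∑ c, (l.count c : ℝ≥0∞) * f c := by
  induction l with
  | nil => simp
  | cons x l ih =>
    rw [List.map_cons, List.sum_cons, ih]
    simp only [List.count_cons, Nat.cast_add, add_mul, Finset.sum_add_distrib]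
    rw [add_comm]
    congr 1
    simp

/-- A critical kernel with branching generates finite trees almost surely. -/
lemma mass_eq_one {K : 𝒳 → List 𝒳 → ℝ≥0∞} (hK : ∀ b, ∑' l, K b l = 1) {v : 𝒳 → ℝ≥0∞}
    (hv : ∀ b, v b ≠ ∞) (hvm : ∀ c, ∑ b, v b * meanMatrix K b c = v c) {c : 𝒳} {b : 𝒳} {k : ℕ}
    (hk : 2 ≤ k) (hb : v b ≠ 0) (hKb : K b (List.replicate k c) ≠ 0) : mass K c = 1 := by
  have hq := fun b => mass_le_one (fun b => (hK b).le) b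
  set q := mass K with hqdef
  set D : List 𝒳 → ℝ≥0∞ := fun l => (l.map q).prod + (l.map fun c => 1 - q c).sum - 1 with hD
  have hD1 : ∀ l, D l + 1 = (l.map q).prod + (l.map fun c => 1 - q c).sum := fun l => by
    refine tsub_add_cancel_of_le ?_
    have := one_le_prod_add_sum_one_sub (l.map q) fun x hx => by
      obtain ⟨c, -, rfl⟩ := List.mem_map.1 hx
      exact hq c
    rwa [List.map_map] at this
  have hsum : ∀ b, ∑' l, K b l * D l + 1 = q b + ∑ c, meanMatrix K b c * (1 - q c) := by
    intro b
    have h1 : ∑' l, K b l * (D l + 1) = ∑' l, K b l * D l + 1 := by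
      simp_rw [mul_add, mul_one]
      rw [ENNReal.tsum_add, hK]
    rw [← h1]
    simp_rw [hD1, mul_add]
    rw [ENNReal.tsum_add, ← mass_eq, ← hqdef]
    congr 1
    simp_rw [sum_map_eq_sum_count, Finset.mul_sum]
    rw [Summable.tsum_finsetSum fun _ _ => ENNReal.summable]
    refine Finset.sum_congr rfl fun c _ => ?_
    rw [meanMatrix, Matrix.of_apply, ← ENNReal.tsum_mul_right]
    exact tsum_congr fun l => by ring
  have htot : ∑ b, v b * (∑' l, K b l * D l) + ∑ b, v b = 0 + ∑ b, v b := by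
    have h2 : ∑ b, v b * (∑' l, K b l * D l + 1) = ∑ b, v b * q b + ∑ c, v c * (1 - q c) := by
      simp_rw [hsum, mul_add, Finset.sum_add_distrib]
      congr 1
      simp_rw [Finset.mul_sum]
      rw [Finset.sum_comm]
      refine Finset.sum_congr rfl fun c _ => ?_
      rw [← hvm c, Finset.sum_mul]
      exact Finset.sum_congr rfl fun b _ => by ring
    simp_rw [mul_add, mul_one, Finset.sum_add_distrib] at h2
    rw [h2, ← Finset.sum_add_distrib, zero_add]
    refine Finset.sum_congr rfl fun b _ => ?_
    rw [← mul_add, add_tsub_cancel_of_le (hq b), mul_one]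
  have hz := (ENNReal.add_left_inj (ENNReal.sum_ne_top.2 fun b _ => hv b)).1 htot
  have hzb := (Finset.sum_eq_zero_iff.1 hz) b (Finset.mem_univ b)
  have hzl := ENNReal.tsum_eq_zero.1 ((mul_eq_zero.1 hzb).resolve_left hb) (List.replicate k c)
  have hDz := (mul_eq_zero.1 hzl).resolve_left hKb
  have := hD1 (List.replicate k c)
  rw [hDz, zero_add, List.map_replicate, List.map_replicate, List.prod_replicate,
    List.sum_replicate, nsmul_eq_mul] at this
  exact eq_one_of_pow_add_eq_one (hq c) hk this.symm

end PTree

namespace PTree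

/-- A vertex on the spine of a context: its type, and the subtrees to the left and to the right of
the next spine vertex. -/
abbrev Frame (𝒳 : Type*) := 𝒳 × List (PTree 𝒳) × List (PTree 𝒳)

/-- Insert a tree into the hole of a context. -/
def plug : List (Frame 𝒳) → PTree 𝒳 → PTree 𝒳
  | [], t => t
  | f :: C, t => node f.1 (f.2.1 ++ plug C t :: f.2.2)

/-- The type of the root of a context whose hole has type `a`. -/
def ctxRoot : List (Frame 𝒳) → 𝒳 → 𝒳
  | [], a => a
  | f :: _, _ => f.1

/-- The types of the children of the first spine vertex `f` of the context `f :: C`. -/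
def frameLabels (f : Frame 𝒳) (c : 𝒳) : List 𝒳 := f.2.1.map root ++ c :: f.2.2.map root

/-- The weight of a context whose hole has type `a`. -/
noncomputable def ctxWeight (K : 𝒳 → List 𝒳 → ℝ≥0∞) : List (Frame 𝒳) → 𝒳 → ℝ≥0∞
  | [], _ => 1
  | f :: C, a => K f.1 (frameLabels f (ctxRoot C a)) * (f.2.1.map (weight K)).prod *
      (f.2.2.map (weight K)).prod * ctxWeight K C a

/-- The number of vertices of a context, the hole excluded. -/
def ctxSize : List (Frame 𝒳) → ℕ
  | [] => 0
  | f :: C => 1 + (f.2.1.map size).sum + (f.2.2.map size).sum + ctxSize C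

/-- The pair counts of a context whose hole has type `a`. -/
noncomputable def ctxCount (a b c : 𝒳) : List (Frame 𝒳) → ℕ
  | [] => 0
  | f :: C => (if f.1 = b then (frameLabels f (ctxRoot C a)).count c else 0) +
      (f.2.1.map fun t => pairCount t b c).sum + (f.2.2.map fun t => pairCount t b c).sum +
      ctxCount a b c C

/-- The index of the hole in the depth-first order. -/
def ctxIndex : List (Frame 𝒳) → ℕ
  | [] => 0
  | f :: C => 1 + (f.2.1.map size).sum + ctxIndex C

lemma root_plug (C : List (Frame 𝒳)) (t : PTree 𝒳) : (plug C t).root = ctxRoot C t.root := by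
  cases C <;> rfl

lemma weight_plug (K : 𝒳 → List 𝒳 → ℝ≥0∞) (C : List (Frame 𝒳)) (t : PTree 𝒳) :
    weight K (plug C t) = ctxWeight K C t.root * weight K t := by
  induction C with
  | nil => simp [plug, ctxWeight]
  | cons f C ih =>
    rw [plug, weight_node, ctxWeight, List.map_append, List.map_cons, root_plug, List.map_append,
      List.map_cons, List.prod_append, List.prod_cons, ih, frameLabels]
    ring

lemma size_plug (C : List (Frame 𝒳)) (t : PTree 𝒳) : (plug C t).size = ctxSize C + t.size := by
  induction C with
  | nil => simp [plug, ctxSize]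
  | cons f C ih =>
    rw [plug, size_node, ctxSize, List.map_append, List.map_cons, List.sum_append, List.sum_cons,
      ih]
    ring

lemma pairCount_plug (C : List (Frame 𝒳)) (t : PTree 𝒳) (b c : 𝒳) :
    pairCount (plug C t) b c = ctxCount t.root b c C + pairCount t b c := by
  induction C with
  | nil => simp [plug, ctxCount]
  | cons f C ih =>
    rw [plug, pairCount_node, ctxCount, List.map_append, List.map_cons, root_plug, List.map_append,
      List.map_cons, List.sum_append, List.sum_cons, ih, frameLabels]
    ring

lemma ctxRoot_append (C D : List (Frame 𝒳)) (a : 𝒳) :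
    ctxRoot (C ++ D) a = ctxRoot C (ctxRoot D a) := by
  cases C <;> rfl

lemma ctxWeight_append (K : 𝒳 → List 𝒳 → ℝ≥0∞) (C D : List (Frame 𝒳)) (a : 𝒳) :
    ctxWeight K (C ++ D) a = ctxWeight K C (ctxRoot D a) * ctxWeight K D a := by
  induction C with
  | nil => simp [ctxWeight]
  | cons f C ih =>
    rw [List.cons_append, ctxWeight, ctxWeight, ctxRoot_append, ih]
    ring

lemma ctxSize_append (C D : List (Frame 𝒳)) : ctxSize (C ++ D) = ctxSize C + ctxSize D := by
  induction C with
  | nil => simp [ctxSize]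
  | cons f C ih => rw [List.cons_append, ctxSize, ctxSize, ih]; ring

lemma ctxCount_append (a b c : 𝒳) (C D : List (Frame 𝒳)) :
    ctxCount a b c (C ++ D) = ctxCount (ctxRoot D a) b c C + ctxCount a b c D := by
  induction C with
  | nil => simp [ctxCount]
  | cons f C ih =>
    rw [List.cons_append, ctxCount, ctxCount, ctxRoot_append, ih]
    ring

lemma eq_nil_of_ctxSize_eq_zero {C : List (Frame 𝒳)} (h : ctxSize C = 0) : C = [] := by
  cases C with
  | nil => rfl
  | cons f C => rw [ctxSize] at h; omega

lemma append_inj_of_ctxSize {C C' D D' : List (Frame 𝒳)} (h : C ++ D = C' ++ D')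
    (hs : ctxSize C = ctxSize C') : C = C' ∧ D = D' := by
  rcases List.append_eq_append_iff.1 h with ⟨X, h1, h2⟩ | ⟨X, h1, h2⟩
  · rw [h1, ctxSize_append] at hs
    have := eq_nil_of_ctxSize_eq_zero (C := X) (by omega)
    subst this
    simp_all
  · rw [h1, ctxSize_append] at hs
    have := eq_nil_of_ctxSize_eq_zero (C := X) (by omega)
    subst this
    simp_all

lemma ctxIndex_lt (C : List (Frame 𝒳)) (t : PTree 𝒳) : ctxIndex C < (plug C t).size := by
  induction C with
  | nil => exact size_pos t
  | cons f C ih =>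
    rw [size_plug] at *
    rw [ctxIndex, ctxSize]
    omega

lemma length_le_of_plug_eq {l l' r r' : List (PTree 𝒳)} {C C' : List (Frame 𝒳)} {t : PTree 𝒳}
    (h : l ++ plug C t :: r = l' ++ plug C' t :: r')
    (hi : (l.map size).sum + ctxIndex C = (l'.map size).sum + ctxIndex C') :
    l'.length ≤ l.length := by
  by_contra! hlt
  rcases List.append_eq_append_iff.1 h with ⟨X, h1, h2⟩ | ⟨X, h1, h2⟩
  · cases X with
    | nil => simp [h1] at hlt
    | cons x X =>
      rw [List.cons_append, List.cons.injEq] at h2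
      have := ctxIndex_lt C t
      rw [h1, List.map_append, List.sum_append, List.map_cons, List.sum_cons, ← h2.1] at hi
      omega
  · rw [h1, List.length_append] at hlt
    omega

lemma plug_ctxIndex_inj (t : PTree 𝒳) (C C' : List (Frame 𝒳)) (h : plug C t = plug C' t)
    (hi : ctxIndex C = ctxIndex C') : C = C' := by
  induction C generalizing C' with
  | nil =>
    cases C' with
    | nil => rfl
    | cons f C' => rw [ctxIndex, ctxIndex] at hi; omega
  | cons f C ih =>
    cases C' with
    | nil => rw [ctxIndex, ctxIndex] at hi; omega
    | cons f' C' =>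
      obtain ⟨b, l, r⟩ := f
      obtain ⟨b', l', r'⟩ := f'
      simp only [plug, node.injEq] at h
      simp only [ctxIndex] at hi
      have hi' : (l.map size).sum + ctxIndex C = (l'.map size).sum + ctxIndex C' := by omega
      have hlen : l.length = l'.length :=
        le_antisymm (length_le_of_plug_eq h.2.symm hi'.symm) (length_le_of_plug_eq h.2 hi')
      obtain ⟨rfl, h2⟩ := List.append_inj h.2 hlen
      rw [List.cons.injEq] at h2
      rw [ih C' h2.1 (by omega), h.1, h2.2]

/-- Each tree arises from at most `size` contexts by inserting a given tree. -/
lemma tsum_plug_le (t : PTree 𝒳) (F : PTree 𝒳 → ℝ≥0∞) :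
    ∑' C, F (plug C t) ≤ ∑' T : PTree 𝒳, (T.size : ℝ≥0∞) * F T := by
  have h1 : ∑' T : PTree 𝒳, (T.size : ℝ≥0∞) * F T =
      ∑' x : (T : PTree 𝒳) × Fin T.size, F x.1 := by
    rw [ENNReal.tsum_sigma']
    refine tsum_congr fun T => ?_
    rw [tsum_fintype]
    simp
  rw [h1]
  refine ENNReal.tsum_comp_le_tsum_of_injective
    (f := fun C => (⟨plug C t, ⟨ctxIndex C, ctxIndex_lt C t⟩⟩ : (T : PTree 𝒳) × Fin T.size)) ?_
    fun x => F x.1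
  intro C C' h
  rw [Sigma.mk.injEq] at h
  refine plug_ctxIndex_inj t C C' h.1 ?_
  have h3 := h.2
  have h4 : plug C t = plug C' t := h.1
  have : ∀ (T T' : PTree 𝒳) (i : Fin T.size) (j : Fin T'.size), T = T' → i ≍ j → (i : ℕ) = j := by
    rintro T T' i j rfl h
    rw [eq_of_heq h]
  exact this _ _ _ _ h4 h3

lemma tsum_frame (K : 𝒳 → List 𝒳 → ℝ≥0∞) (hm : ∀ b, mass K b = 1) (b c : 𝒳) :
    ∑' l : List (PTree 𝒳), ∑' r : List (PTree 𝒳), K b (l.map root ++ c :: r.map root) *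
      (l.map (weight K)).prod * (r.map (weight K)).prod = meanMatrix K b c := by
  have hprod : ∀ l : List 𝒳, (l.map (mass K)).prod = 1 := fun l => by
    induction l with
    | nil => simp
    | cons x l ih => simp [ih, hm]
  have h1 : ∀ l : List (PTree 𝒳), ∑' r : List (PTree 𝒳), K b (l.map root ++ c :: r.map root) *
      (l.map (weight K)).prod * (r.map (weight K)).prod =
      (∑' r : List 𝒳, K b (l.map root ++ c :: r)) * (l.map (weight K)).prod := by
    intro l
    have := tsum_forest K fun r => K b (l.map root ++ c :: r) * (l.map (weight K)).prod
    rw [this, ← ENNReal.tsum_mul_right]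
    exact tsum_congr fun r => by rw [hprod, mul_one]
  simp_rw [h1]
  rw [tsum_forest K fun l => ∑' r : List 𝒳, K b (l ++ c :: r)]
  simp_rw [hprod, mul_one]
  exact ENNReal.tsum_list_insert (K b) c

lemma tsum_ctxWeight (K : 𝒳 → List 𝒳 → ℝ≥0∞) (hm : ∀ b, mass K b = 1) (a c : 𝒳) (h : ℕ) :
    ∑' C : List (Frame 𝒳), (if C.length = h then
      (if ctxRoot C c = a then ctxWeight K C c else 0) else 0) = (meanMatrix K ^ h) a c := by
  induction h generalizing a with
  | zero =>
    rw [ENNReal.tsum_list_zero fun C => if ctxRoot C c = a then ctxWeight K C c else 0]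
    rw [pow_zero, Matrix.one_apply]
    rcases eq_or_ne a c with rfl | hac
    · simp [ctxRoot, ctxWeight]
    · simp [ctxRoot, hac, hac.symm]
  | succ h ih =>
    rw [ENNReal.tsum_list_succ fun C => if ctxRoot C c = a then ctxWeight K C c else 0, pow_succ',
      Matrix.mul_apply]
    simp_rw [← ih, ← ENNReal.tsum_mul_left]
    rw [← Summable.tsum_finsetSum fun _ _ => ENNReal.summable, ENNReal.tsum_comm]
    refine tsum_congr fun C => ?_
    rw [ENNReal.tsum_prod', tsum_eq_single a fun b hb => by simp [ctxRoot, hb],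
      Finset.sum_eq_single (ctxRoot C c) (fun b _ hb => by simp [hb.symm]) (by simp),
      ENNReal.tsum_prod', ← tsum_frame K hm]
    simp_rw [← ENNReal.tsum_mul_right]
    refine tsum_congr fun l => tsum_congr fun r => ?_
    simp only [ctxRoot, if_true, ctxWeight, frameLabels]
    split_ifs <;> simp

end PTree

/-- The pair counts `cnt` of total mass `N` are `N ε`-close to `N μ`. -/
def NearCount (μ : 𝒳 × 𝒳 → ℝ) (ε : ℝ) (N : ℕ) (cnt : 𝒳 → 𝒳 → ℕ) : Prop :=
  ∀ x : 𝒳 × 𝒳, |(cnt x.1 x.2 : ℝ) - N * μ x| ≤ N * ε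

lemma NearCount.add {μ : 𝒳 × 𝒳 → ℝ} {ε : ℝ} {N M : ℕ} {f g : 𝒳 → 𝒳 → ℕ}
    (hf : NearCount μ ε N f) (hg : NearCount μ ε M g) :
    NearCount μ ε (N + M) fun b c => f b c + g b c := by
  intro x
  have h1 := hf x
  have h2 := hg x
  push_cast
  have := abs_add_le ((f x.1 x.2 : ℝ) - N * μ x) ((g x.1 x.2 : ℝ) - M * μ x)
  calc |(f x.1 x.2 : ℝ) + g x.1 x.2 - (N + M) * μ x|
      = |((f x.1 x.2 : ℝ) - N * μ x) + ((g x.1 x.2 : ℝ) - M * μ x)| := by ring_nf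
    _ ≤ _ := by linarith

namespace PTree

lemma sum_pairCount (t : PTree 𝒳) : ∑ x : 𝒳 × 𝒳, pairCount t x.1 x.2 + 1 = t.size := by
  induction t using induction_on with
  | h a ts ih =>
    have h1 : ∑ x : 𝒳 × 𝒳, (if a = x.1 then (ts.map root).count x.2 else 0) = ts.length := by
      rw [Fintype.sum_prod_type, Finset.sum_eq_single a (fun b _ hb => by simp [hb.symm]) (by simp)]
      simp only [if_true]
      have := List.sum_toFinset_count_eq_length (ts.map root)
      rw [List.length_map] at this
      rw [← this]
      refine (Finset.sum_subset (Finset.subset_univ _) fun c _ hc => ?_).symm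
      exact List.count_eq_zero_of_not_mem fun h => hc (List.mem_toFinset.2 h)
    have h2 : ∀ l : List (PTree 𝒳), (∀ s ∈ l, ∑ x : 𝒳 × 𝒳, pairCount s x.1 x.2 + 1 = s.size) →
        ∑ x : 𝒳 × 𝒳, (l.map fun t => pairCount t x.1 x.2).sum + l.length = (l.map size).sum := by
      intro l hl
      induction l with
      | nil => simp
      | cons s l ihl =>
        simp only [List.map_cons, List.sum_cons, Finset.sum_add_distrib, List.length_cons]
        have h3 := hl s (by simp)
        have h4 := ihl fun s hs => hl s (by simp [hs])
        omega
    simp only [pairCount_node, Finset.sum_add_distrib, size_node]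
    rw [h1]
    have := h2 ts ih
    omega

lemma pairCount_lt_size (t : PTree 𝒳) (b c : 𝒳) : pairCount t b c < t.size := by
  rw [← sum_pairCount t, Nat.lt_succ_iff]
  exact Finset.single_le_sum (f := fun x : 𝒳 × 𝒳 => pairCount t x.1 x.2)
    (fun _ _ => Nat.zero_le _) (Finset.mem_univ (b, c))

/-- Contexts with `N` vertices whose root and hole have type `a` and whose pair counts are close to
`N μ`. -/
def goodCtx (μ : 𝒳 × 𝒳 → ℝ) (ε : ℝ) (a : 𝒳) (N : ℕ) : Set (List (Frame 𝒳)) :=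
  {C | ctxSize C = N ∧ ctxRoot C a = a ∧ NearCount μ ε N fun b c => ctxCount a b c C}

open Classical in
/-- The total weight of `goodCtx`. -/
noncomputable def goodMass (K : 𝒳 → List 𝒳 → ℝ≥0∞) (μ : 𝒳 × 𝒳 → ℝ) (ε : ℝ) (a : 𝒳) (N : ℕ) :
    ℝ≥0∞ :=
  ∑' C, if C ∈ goodCtx μ ε a N then ctxWeight K C a else 0

lemma goodMass_mul_le (K : 𝒳 → List 𝒳 → ℝ≥0∞) (μ : 𝒳 × 𝒳 → ℝ) (ε : ℝ) (a : 𝒳) (N M : ℕ) :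
    goodMass K μ ε a N * goodMass K μ ε a M ≤ goodMass K μ ε a (N + M) := by
  simp_rw [goodMass, ← ENNReal.tsum_mul_right, ← ENNReal.tsum_mul_left]
  rw [← ENNReal.tsum_prod]
  refine ENNReal.tsum_le_tsum_of_injOn (i := fun x => x.1 ++ x.2)
    (goodCtx μ ε a N ×ˢ goodCtx μ ε a M) ?_ ?_ ?_
  · rintro ⟨C, D⟩ ⟨hC, -⟩ ⟨C', D'⟩ ⟨hC', -⟩ h
    exact Prod.ext_iff.2 (append_inj_of_ctxSize h (hC.1.trans hC'.1.symm))
  · rintro ⟨C, D⟩ h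
    by_cases hC : C ∈ goodCtx μ ε a N
    · have hD : D ∉ goodCtx μ ε a M := fun hD => h ⟨hC, hD⟩
      simp [hD]
    · simp [hC]
  · rintro ⟨C, D⟩ ⟨hC, hD⟩
    have hCD : C ++ D ∈ goodCtx μ ε a (N + M) := by
      refine ⟨?_, ?_, ?_⟩
      · rw [ctxSize_append, hC.1, hD.1]
      · rw [ctxRoot_append, hD.2.1, hC.2.1]
      · simp_rw [ctxCount_append, hD.2.1]
        exact hC.2.2.add hD.2.2
    simp only at hC hD ⊢
    rw [if_pos hC, if_pos hD, if_pos hCD, ctxWeight_append, hD.2.1]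

lemma one_le_goodMass_zero (K : 𝒳 → List 𝒳 → ℝ≥0∞) (μ : 𝒳 × 𝒳 → ℝ) (ε : ℝ) (a : 𝒳) :
    1 ≤ goodMass K μ ε a 0 := by
  have h : ([] : List (Frame 𝒳)) ∈ goodCtx μ ε a 0 :=
    ⟨rfl, rfl, fun x => by simp [ctxCount]⟩
  refine le_trans ?_ (ENNReal.le_tsum ([] : List (Frame 𝒳)))
  rw [if_pos h, ctxWeight]

lemma goodMass_zero_le (K : 𝒳 → List 𝒳 → ℝ≥0∞) (μ : 𝒳 × 𝒳 → ℝ) (ε : ℝ) (a : 𝒳) :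
    goodMass K μ ε a 0 ≤ 1 := by
  rw [goodMass, tsum_eq_single [] fun C hC =>
    if_neg fun h => hC (eq_nil_of_ctxSize_eq_zero h.1)]
  split_ifs <;> simp [ctxWeight]

lemma goodMass_pow_le (K : 𝒳 → List 𝒳 → ℝ≥0∞) (μ : 𝒳 × 𝒳 → ℝ) (ε : ℝ) (a : 𝒳) (L m : ℕ) :
    goodMass K μ ε a L ^ m ≤ goodMass K μ ε a (m * L) := by
  induction m with
  | zero => simpa using one_le_goodMass_zero K μ ε a
  | succ m ih =>
    rw [pow_succ, add_mul, one_mul]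
    exact (mul_le_mul_left ih _).trans (goodMass_mul_le K μ ε a _ _)

open Classical in
/-- The kernel `K` gives exponentially small weight to trees with `n` edges whose pair counts are
not close to `n μ`. -/
def Concentrates (K : 𝒳 → List 𝒳 → ℝ≥0∞) (μ : 𝒳 × 𝒳 → ℝ) (ε : ℝ) : Prop :=
  ∃ B : ℝ≥0∞, B ≠ ∞ ∧ ∃ r : ℝ, 0 < r ∧ ∀ n : ℕ,
    ∑' t : PTree 𝒳, (if t.size = n + 1 ∧ ¬ NearCount μ ε n (pairCount t) then weight K t else 0) ≤
      B * ENNReal.ofReal (Real.exp (-r * n))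

open Classical in
lemma tsum_badCtx_ne_top {K : 𝒳 → List 𝒳 → ℝ≥0∞} {μ : 𝒳 × 𝒳 → ℝ} {ε : ℝ} {a : 𝒳}
    (ha : K a [] ≠ 0) (hbad : Concentrates K μ ε) :
    ∑' n : ℕ, ∑' C : List (Frame 𝒳), (if ctxSize C = n ∧ ctxRoot C a = a ∧
      ¬ NearCount μ ε n (fun b c => ctxCount a b c C) then ctxWeight K C a else 0) ≠ ∞ := by
  obtain ⟨B, hB, r, hr, hbd⟩ := hbad
  set bad : ℕ → ℝ≥0∞ := fun n => ∑' C : List (Frame 𝒳), (if ctxSize C = n ∧ ctxRoot C a = a ∧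
      ¬ NearCount μ ε n (fun b c => ctxCount a b c C) then ctxWeight K C a else 0) with hbaddef
  have hleaf : weight K (node a []) = K a [] := by simp [weight_node]
  have hpc : ∀ b c, pairCount (node a []) b c = 0 := fun b c => by simp [pairCount_node]
  have h1 : ∀ n, bad n * K a [] ≤ B * ENNReal.ofReal ((n + 1) * Real.exp (-r * n)) := by
    intro n
    calc bad n * K a [] = ∑' C : List (Frame 𝒳), if ctxSize C = n ∧ ctxRoot C a = a ∧
          ¬ NearCount μ ε n (fun b c => ctxCount a b c C) then ctxWeight K C a * K a [] else 0 := by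
          rw [hbaddef, ← ENNReal.tsum_mul_right]
          exact tsum_congr fun C => by rw [ite_mul, zero_mul]
      _ ≤ ∑' C : List (Frame 𝒳), (fun T : PTree 𝒳 => if T.size = n + 1 ∧
          ¬ NearCount μ ε n (pairCount T) then weight K T else 0) (plug C (node a [])) := by
          refine ENNReal.tsum_le_tsum fun C => ?_
          split_ifs with h
          · have h2 : (plug C (node a [])).size = n + 1 ∧
                ¬ NearCount μ ε n (pairCount (plug C (node a []))) := by
              refine ⟨by rw [size_plug, h.1]; simp [size_node], ?_⟩
              have h3 : pairCount (plug C (node a [])) = fun b c => ctxCount a b c C := by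
                funext b c
                rw [pairCount_plug, hpc]
                rfl
              rw [h3]
              exact h.2.2
            simp only [if_pos h2]
            rw [weight_plug, hleaf]
            exact le_rfl
          · exact zero_le
      _ ≤ ∑' T : PTree 𝒳, (T.size : ℝ≥0∞) * (if T.size = n + 1 ∧
          ¬ NearCount μ ε n (pairCount T) then weight K T else 0) := tsum_plug_le _ _
      _ = (n + 1 : ℕ) * ∑' T : PTree 𝒳, (if T.size = n + 1 ∧
          ¬ NearCount μ ε n (pairCount T) then weight K T else 0) := by
          rw [← ENNReal.tsum_mul_left]
          refine tsum_congr fun T => ?_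
          split_ifs with h
          · rw [h.1]
          · simp
      _ ≤ (n + 1 : ℕ) * (B * ENNReal.ofReal (Real.exp (-r * n))) := by gcongr; exact hbd n
      _ = _ := by
          rw [ENNReal.ofReal_mul (by positivity), ← Nat.cast_add_one, ENNReal.ofReal_natCast]
          ring
  have h2 : (∑' n, bad n) * K a [] ≠ ∞ := by
    rw [← ENNReal.tsum_mul_right]
    refine ne_top_of_le_ne_top ?_ (ENNReal.tsum_le_tsum h1)
    rw [ENNReal.tsum_mul_left]
    refine ENNReal.mul_ne_top hB (Summable.tsum_ofReal_ne_top ?_)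
    have s1 := Real.summable_pow_mul_exp_neg_nat_mul 1 hr
    have s0 := Real.summable_pow_mul_exp_neg_nat_mul 0 hr
    refine (s1.add s0).congr fun n => ?_
    ring
  intro h3
  rw [h3, ENNReal.top_mul ha] at h2
  exact h2 rfl

lemma exists_le_goodMass {K : 𝒳 → List 𝒳 → ℝ≥0∞} (hm : ∀ b, mass K b = 1) {μ : 𝒳 × 𝒳 → ℝ} {ε : ℝ}
    {a : 𝒳} (hdiv : ∑' h : ℕ, (meanMatrix K ^ h) a a = ∞) (ha : K a [] ≠ 0)
    (hbad : Concentrates K μ ε) {δ : ℝ} (hδ : 0 < δ) :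
    ∃ L : ℕ, 0 < L ∧ ENNReal.ofReal (Real.exp (-δ * L)) ≤ goodMass K μ ε a L := by
  classical
  by_contra! hlt
  have hgood : ∑' n, goodMass K μ ε a n ≠ ∞ := by
    refine ne_top_of_le_ne_top (b := ∑' n : ℕ, ENNReal.ofReal (Real.exp (-δ * n))) ?_
      (ENNReal.tsum_le_tsum fun n => ?_)
    · refine Summable.tsum_ofReal_ne_top ?_
      exact (Real.summable_pow_mul_exp_neg_nat_mul 0 hδ).congr fun n => by ring
    · rcases Nat.eq_zero_or_pos n with rfl | hn
      · simpa using goodMass_zero_le K μ ε a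
      · exact (hlt n hn).le
  have htot : ∑' h : ℕ, (meanMatrix K ^ h) a a ≤ ∑' n, goodMass K μ ε a n +
      ∑' n : ℕ, ∑' C : List (Frame 𝒳), (if ctxSize C = n ∧ ctxRoot C a = a ∧
        ¬ NearCount μ ε n (fun b c => ctxCount a b c C) then ctxWeight K C a else 0) := by
    simp_rw [← tsum_ctxWeight K hm]
    rw [← ENNReal.tsum_list_length fun C => if ctxRoot C a = a then ctxWeight K C a else 0,
      ← ENNReal.tsum_add]
    simp_rw [goodMass, ← ENNReal.tsum_add]
    rw [ENNReal.tsum_comm]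
    refine ENNReal.tsum_le_tsum fun C => ?_
    refine le_trans ?_ (ENNReal.le_tsum (ctxSize C))
    split_ifs with h1 h2 h3 h3 <;> simp_all [goodCtx]
  rw [hdiv] at htot
  exact ENNReal.add_ne_top.2 ⟨hgood, tsum_badCtx_ne_top ha hbad⟩ (top_le_iff.1 htot)

open Classical in
/-- The total weight of the trees with `n` vertices and root of type `a` whose pair counts are close
to `(n - 1) μ`. -/
noncomputable def goodTreeMass (K : 𝒳 → List 𝒳 → ℝ≥0∞) (μ : 𝒳 × 𝒳 → ℝ) (ε : ℝ) (a : 𝒳) (n : ℕ) :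
    ℝ≥0∞ :=
  ∑' t : PTree 𝒳, if t.size = n ∧ t.root = a ∧ NearCount μ ε (n - 1) (pairCount t)
    then weight K t else 0

lemma goodMass_mul_weight_le (K : 𝒳 → List 𝒳 → ℝ≥0∞) {μ : 𝒳 × 𝒳 → ℝ} (hμ : ∀ x, 0 ≤ μ x ∧ μ x ≤ 1)
    {ε : ℝ} (hε : 0 < ε) (N : ℕ) (t : PTree 𝒳) (ht : (t.size : ℝ) ≤ N * ε) :
    goodMass K μ ε t.root N * weight K t ≤
      (N + t.size : ℕ) * goodTreeMass K μ (2 * ε) t.root (N + t.size) := by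
  classical
  have hsz := size_pos t
  have hN1 : ((N + t.size - 1 : ℕ) : ℝ) = N + (t.size - 1) := by
    rw [Nat.cast_sub (by omega)]; push_cast; ring
  calc goodMass K μ ε t.root N * weight K t
      ≤ ∑' C : List (Frame 𝒳), (fun T : PTree 𝒳 => if T.size = N + t.size ∧ T.root = t.root ∧
          NearCount μ (2 * ε) (N + t.size - 1) (pairCount T) then weight K T else 0) (plug C t) := by
        rw [goodMass, ← ENNReal.tsum_mul_right]
        refine ENNReal.tsum_le_tsum fun C => ?_
        split_ifs with h
        · have h2 : (plug C t).size = N + t.size ∧ (plug C t).root = t.root ∧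
              NearCount μ (2 * ε) (N + t.size - 1) (pairCount (plug C t)) := by
            refine ⟨by rw [size_plug, h.1], by rw [root_plug, h.2.1], fun x => ?_⟩
            have h3 := h.2.2 x
            have h4 : (pairCount t x.1 x.2 : ℝ) + 1 ≤ t.size := by
              exact_mod_cast pairCount_lt_size t x.1 x.2
            have h5 : (0 : ℝ) ≤ pairCount t x.1 x.2 := Nat.cast_nonneg _
            have h6 : (1 : ℝ) ≤ t.size := by exact_mod_cast hsz
            have h7 := hμ x
            rw [pairCount_plug, hN1]
            push_cast
            rw [abs_le] at h3 ⊢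
            have h8 : 0 ≤ ((t.size : ℝ) - 1) * μ x := mul_nonneg (by linarith) h7.1
            have h9 : ((t.size : ℝ) - 1) * μ x ≤ (t.size - 1) * 1 :=
              mul_le_mul_of_nonneg_left h7.2 (by linarith)
            have h10 : 0 ≤ ((t.size : ℝ) - 1) * ε := mul_nonneg (by linarith) hε.le
            constructor <;> nlinarith
          simp only [if_pos h2]
          rw [weight_plug]
        · simp
    _ ≤ ∑' T : PTree 𝒳, (T.size : ℝ≥0∞) * (if T.size = N + t.size ∧ T.root = t.root ∧
          NearCount μ (2 * ε) (N + t.size - 1) (pairCount T) then weight K T else 0) :=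
        tsum_plug_le _ _
    _ = _ := by
        rw [goodTreeMass, ← ENNReal.tsum_mul_left]
        refine tsum_congr fun T => ?_
        split_ifs with h
        · rw [h.1]
        · simp

lemma eventually_nat_le_mul_exp {w δ : ℝ} (hw : 0 < w) (hδ : 0 < δ) :
    ∀ᶠ n : ℕ in atTop, (n : ℝ) ≤ w * Real.exp (δ * n) := by
  have h := (Real.summable_pow_mul_exp_neg_nat_mul 1 hδ).tendsto_atTop_zero
  filter_upwards [h.eventually_lt_const hw] with n hn
  rw [pow_one, neg_mul, Real.exp_neg, ← div_eq_mul_inv, div_lt_iff₀ (Real.exp_pos _)] at hn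
  exact hn.le

/-- Subexponential lower bound for the weight of the trees with `n` vertices and pair counts close
to `(n - 1) μ`, along the possible values of `n`. -/
lemma eventually_le_goodTreeMass {K : 𝒳 → List 𝒳 → ℝ≥0∞} (hm : ∀ b, mass K b = 1) {μ : 𝒳 × 𝒳 → ℝ}
    (hμ : ∀ x, 0 ≤ μ x ∧ μ x ≤ 1) {ε : ℝ} (hε : 0 < ε)
    {a : 𝒳} (hdiv : ∑' h : ℕ, (meanMatrix K ^ h) a a = ∞) (ha : K a [] ≠ 0)
    (hbad : Concentrates K μ ε) {δ : ℝ} (hδ : 0 < δ) :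
    ∀ᶠ n : ℕ in atTop, (∃ t : PTree 𝒳, t.size = n ∧ t.root = a ∧ weight K t ≠ 0) →
      ENNReal.ofReal (Real.exp (-δ * n)) ≤ goodTreeMass K μ (2 * ε) a n := by
  obtain ⟨L, hL, hLg⟩ := exists_le_goodMass hm hdiv ha hbad (half_pos hδ)
  have hres : ∀ r : Fin L, ∀ᶠ n : ℕ in atTop, n % L = r →
      (∃ t : PTree 𝒳, t.size = n ∧ t.root = a ∧ weight K t ≠ 0) →
      ENNReal.ofReal (Real.exp (-δ * n)) ≤ goodTreeMass K μ (2 * ε) a n := by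
    intro r
    by_cases hex : ∃ t : PTree 𝒳, t.size % L = r ∧ t.root = a ∧ weight K t ≠ 0
    swap
    · refine Eventually.of_forall fun n hn ht => absurd ?_ hex
      obtain ⟨t, rfl, h1, h2⟩ := ht
      exact ⟨t, hn, h1, h2⟩
    obtain ⟨t, htr, rfl, hwt⟩ := hex
    have hwtop : weight K t ≠ ∞ := by
      refine ne_top_of_le_ne_top ENNReal.one_ne_top ?_
      rw [← hm t.root, mass]
      refine le_trans ?_ (ENNReal.le_tsum t)
      rw [if_pos rfl]
    have hw := ENNReal.toReal_pos hwt hwtop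
    have hlarge : ∀ᶠ n : ℕ in atTop, (t.size : ℝ) / ε + t.size ≤ n :=
      tendsto_natCast_atTop_atTop.eventually_ge_atTop _
    filter_upwards [eventually_nat_le_mul_exp hw (half_pos hδ), hlarge, eventually_ge_atTop t.size]
      with n hn1 hn2 hn3 hnr _
    obtain ⟨m, hmn⟩ : ∃ m, n = m * L + t.size := by
      have h1 : n ≡ t.size [MOD L] := hnr.trans htr.symm
      obtain ⟨m, hm⟩ := (Nat.modEq_iff_dvd' hn3).1 h1.symm
      exact ⟨m, by rw [mul_comm, ← hm]; omega⟩
    have hnpos : n ≠ 0 := by have := size_pos t; omega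
    have hN : (t.size : ℝ) ≤ (m * L : ℕ) * ε := by
      rw [hmn] at hn2
      push_cast at hn2 ⊢
      rw [← div_le_iff₀ hε]
      linarith
    have h1 := goodMass_mul_weight_le K hμ hε (m * L) t hN
    rw [← hmn] at h1
    have h2 : ENNReal.ofReal (Real.exp (-(δ / 2) * L)) ^ m * weight K t ≤
        n * goodTreeMass K μ (2 * ε) t.root n :=
      (mul_le_mul_left ((pow_le_pow_left₀ zero_le hLg m).trans (goodMass_pow_le K μ ε _ L m))
        _).trans h1
    refine (ENNReal.mul_le_mul_iff_right (a := (n : ℝ≥0∞)) (by simpa using hnpos)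
      (ENNReal.natCast_ne_top n)).1 (le_trans ?_ h2)
    rw [← ENNReal.ofReal_pow (Real.exp_pos _).le, ← ENNReal.ofReal_toReal hwtop,
      ← ENNReal.ofReal_natCast, ← ENNReal.ofReal_mul (by positivity),
      ← ENNReal.ofReal_mul (by positivity), ← Real.exp_nat_mul]
    refine ENNReal.ofReal_le_ofReal ?_
    have h3 : Real.exp (-(δ / 2) * n) ≤ Real.exp (m * (-(δ / 2) * L)) := by
      refine Real.exp_le_exp.2 ?_
      rw [hmn]
      push_cast
      nlinarith [Nat.cast_nonneg (α := ℝ) t.size]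
    calc (n : ℝ) * Real.exp (-δ * n)
        ≤ (weight K t).toReal * Real.exp (δ / 2 * n) * Real.exp (-δ * n) := by gcongr
      _ = Real.exp (-(δ / 2) * n) * (weight K t).toReal := by
          rw [mul_assoc, ← Real.exp_add, mul_comm]
          ring_nf
      _ ≤ _ := by gcongr
  filter_upwards [eventually_all.2 hres] with n hn
  exact hn ⟨n % L, Nat.mod_lt _ hL⟩ rfl

end PTree

namespace ENNReal

lemma tsum_list_prod (w : 𝒳 → ℝ≥0∞) (k : ℕ) :
    ∑' l : List 𝒳, (if l.length = k then (l.map w).prod else 0) = (∑ a, w a) ^ k := by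
  induction k with
  | zero => rw [tsum_list_zero fun l => (l.map w).prod]; simp
  | succ k ih =>
    rw [tsum_list_succ fun l => (l.map w).prod, pow_succ', ← ih, Finset.sum_mul, tsum_fintype]
    refine Finset.sum_congr rfl fun a _ => ?_
    rw [← ENNReal.tsum_mul_left]
    exact tsum_congr fun l => by simp

lemma tsum_list_prod_mul_count (w : 𝒳 → ℝ≥0∞) (c : 𝒳) (k : ℕ) :
    (∑' l : List 𝒳, if l.length = k then (l.map w).prod * (l.count c : ℝ≥0∞) else 0) *
      ∑ a, w a = k * w c * (∑ a, w a) ^ k := by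
  induction k with
  | zero => rw [tsum_list_zero fun l => (l.map w).prod * (l.count c : ℝ≥0∞)]; simp
  | succ k ih =>
    rw [tsum_list_succ fun l => (l.map w).prod * (l.count c : ℝ≥0∞), tsum_fintype]
    have h : ∀ a, ∑' l : List 𝒳, (if l.length = k
        then ((a :: l).map w).prod * ((a :: l).count c : ℝ≥0∞) else 0) =
        w a * (∑' l : List 𝒳, if l.length = k then (l.map w).prod * (l.count c : ℝ≥0∞) else 0) +
        (if a = c then w a else 0) * (∑ a, w a) ^ k := by
      intro a
      rw [← tsum_list_prod, ← ENNReal.tsum_mul_left, ← ENNReal.tsum_mul_left, ← ENNReal.tsum_add]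
      refine tsum_congr fun l => ?_
      rw [List.map_cons, List.prod_cons, List.count_cons]
      by_cases hl : l.length = k <;> by_cases hac : a = c <;> simp [hl, hac] <;> ring
    simp_rw [h, Finset.sum_add_distrib, ← Finset.sum_mul]
    rw [Finset.sum_ite_eq' Finset.univ c w, if_pos (Finset.mem_univ c), add_mul, mul_assoc, ih]
    push_cast
    ring

lemma ofReal_list_prod_map {α : Type*} (l : List α) (f : α → ℝ) (hf : ∀ a, 0 ≤ f a) :
    ENNReal.ofReal (l.map f).prod = (l.map fun a => ENNReal.ofReal (f a)).prod := by
  induction l with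
  | nil => simp
  | cons a l ih => rw [List.map_cons, List.prod_cons, ENNReal.ofReal_mul (hf a), ih]; simp

end ENNReal

section Kernel

variable {p : ℕ → ℝ} {Q : 𝒳 → 𝒳 → ℝ}

/-- The law of the types of the children of a vertex of type `b`, exponentially tilted by `g`. -/
noncomputable def tiltedKernel (p : ℕ → ℝ) (Q g : 𝒳 → 𝒳 → ℝ) (b : 𝒳) (l : List 𝒳) : ℝ≥0∞ :=
  ENNReal.ofReal (p l.length) * (l.map fun c => ENNReal.ofReal (Q b c * Real.exp (g b c))).prod *
    ENNReal.ofReal (Real.exp (-vertexCost p Q g b))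

lemma sum_ofReal_tilt (hQ : IsIrreducibleKernel Q) (g : 𝒳 → 𝒳 → ℝ) (b : 𝒳) :
    ∑ c, ENNReal.ofReal (Q b c * Real.exp (g b c)) =
      ENNReal.ofReal (Real.exp (logTilt Q g b)) := by
  rw [hQ.exp_logTilt, ENNReal.ofReal_sum_of_nonneg]
  exact fun c _ => mul_nonneg (hQ.nonneg b c) (Real.exp_pos _).le

lemma exp_neg_vertexCost (hp : IsCriticalOffspring p) (g : 𝒳 → 𝒳 → ℝ) (b : 𝒳) :
    Real.exp (-vertexCost p Q g b) = (offspringMgf p (logTilt Q g b))⁻¹ := by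
  rw [Real.exp_neg, vertexCost, Real.exp_log (hp.mgf_pos _)]

lemma tsum_tiltedKernel (hp : IsCriticalOffspring p) (hQ : IsIrreducibleKernel Q)
    (g : 𝒳 → 𝒳 → ℝ) (b : 𝒳) : ∑' l, tiltedKernel p Q g b l = 1 := by
  simp_rw [tiltedKernel]
  rw [ENNReal.tsum_mul_right, ENNReal.tsum_list_length]
  have h : ∀ k : ℕ, ∑' l : List 𝒳, (if l.length = k then ENNReal.ofReal (p l.length) *
      (l.map fun c => ENNReal.ofReal (Q b c * Real.exp (g b c))).prod else 0) =
      ENNReal.ofReal (p k * Real.exp (logTilt Q g b * k)) := by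
    intro k
    rw [ENNReal.ofReal_mul (hp.nonneg k), mul_comm (logTilt Q g b), Real.exp_nat_mul,
      ENNReal.ofReal_pow (Real.exp_pos _).le, ← sum_ofReal_tilt hQ, ← ENNReal.tsum_list_prod,
      ← ENNReal.tsum_mul_left]
    refine tsum_congr fun l => ?_
    split_ifs with hl
    · rw [hl]
    · simp
  simp_rw [h]
  rw [← ENNReal.ofReal_tsum_of_nonneg (fun k => mul_nonneg (hp.nonneg k) (Real.exp_pos _).le)
    (hp.summable_exp _), ← ENNReal.ofReal_mul (tsum_nonneg fun k =>
      mul_nonneg (hp.nonneg k) (Real.exp_pos _).le), exp_neg_vertexCost hp, ← offspringMgf,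
    mul_inv_cancel₀ (hp.mgf_pos _).ne', ENNReal.ofReal_one]

/-- The mean number of children of type `c` of a vertex of type `b` under `tiltedKernel p Q g`. -/
noncomputable def tiltedMean (p : ℕ → ℝ) (Q g : 𝒳 → 𝒳 → ℝ) (b c : 𝒳) : ℝ :=
  Q b c * Real.exp (g b c) / Real.exp (logTilt Q g b) *
    (offspringMgfDeriv p (logTilt Q g b) / offspringMgf p (logTilt Q g b))

lemma meanMatrix_tiltedKernel (hp : IsCriticalOffspring p) (hQ : IsIrreducibleKernel Q)
    (g : 𝒳 → 𝒳 → ℝ) (b c : 𝒳) :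
    PTree.meanMatrix (tiltedKernel p Q g) b c = ENNReal.ofReal (tiltedMean p Q g b c) := by
  have hU := Real.exp_pos (logTilt Q g b)
  have hU0 : ENNReal.ofReal (Real.exp (logTilt Q g b)) ≠ 0 := by simpa using hU
  rw [← ENNReal.mul_left_inj hU0 ENNReal.ofReal_ne_top]
  rw [← ENNReal.ofReal_mul' hU.le, tiltedMean]
  have h : ∀ k : ℕ, (∑' l : List 𝒳, if l.length = k then tiltedKernel p Q g b l * l.count c else 0) *
      ENNReal.ofReal (Real.exp (logTilt Q g b)) = ENNReal.ofReal (p k *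
        (k * Real.exp (logTilt Q g b * k)) * (Q b c * Real.exp (g b c) *
        Real.exp (-vertexCost p Q g b))) := by
    intro k
    have h1 := ENNReal.tsum_list_prod_mul_count
      (fun c => ENNReal.ofReal (Q b c * Real.exp (g b c))) c k
    rw [sum_ofReal_tilt hQ] at h1
    have h2 : (∑' l : List 𝒳, if l.length = k then tiltedKernel p Q g b l * l.count c else 0) =
        ENNReal.ofReal (p k) * ENNReal.ofReal (Real.exp (-vertexCost p Q g b)) *
        ∑' l : List 𝒳, if l.length = k then
          (l.map fun c => ENNReal.ofReal (Q b c * Real.exp (g b c))).prod * l.count c else 0 := by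
      rw [← ENNReal.tsum_mul_left]
      refine tsum_congr fun l => ?_
      split_ifs with hl
      · rw [tiltedKernel, hl]; ring
      · simp
    rw [h2, mul_assoc, h1, ← ENNReal.ofReal_pow hU.le, ← ENNReal.ofReal_natCast,
      ← ENNReal.ofReal_mul (hp.nonneg k), ← ENNReal.ofReal_mul (Nat.cast_nonneg k),
      ← ENNReal.ofReal_mul (mul_nonneg (Nat.cast_nonneg k)
        (mul_nonneg (hQ.nonneg b c) (Real.exp_pos _).le)),
      ← ENNReal.ofReal_mul (mul_nonneg (hp.nonneg k) (Real.exp_pos _).le),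
      mul_comm (logTilt Q g b), Real.exp_nat_mul]
    congr 1
    ring
  rw [PTree.meanMatrix, Matrix.of_apply, ENNReal.tsum_list_length, ← ENNReal.tsum_mul_right]
  simp_rw [h]
  rw [← ENNReal.ofReal_tsum_of_nonneg, tsum_mul_right, ← offspringMgfDeriv, exp_neg_vertexCost hp]
  · congr 1
    field_simp
  · exact fun k => mul_nonneg (mul_nonneg (hp.nonneg k)
      (mul_nonneg (Nat.cast_nonneg k) (Real.exp_pos _).le))
      (mul_nonneg (mul_nonneg (hQ.nonneg b c) (Real.exp_pos _).le) (Real.exp_pos _).le)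
  · exact (hp.summable_mul_exp _).mul_right _

lemma vertexCost_zero (hp : IsCriticalOffspring p) (hQ : IsIrreducibleKernel Q) (b : 𝒳) :
    vertexCost p Q 0 b = 0 := by
  rw [vertexCost, logTilt_zero hQ, hp.mgf_zero, Real.log_one]

lemma tiltedKernel_zero (hp : IsCriticalOffspring p) (hQ : IsIrreducibleKernel Q) (b : 𝒳)
    (l : List 𝒳) :
    tiltedKernel p Q 0 b l = ENNReal.ofReal (p l.length * (l.map (Q b)).prod) := by
  rw [ENNReal.ofReal_mul (hp.nonneg _), ENNReal.ofReal_list_prod_map l _ (hQ.nonneg b),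
    tiltedKernel, vertexCost_zero hp hQ]
  simp

lemma list_prod_map_mul_ofReal_exp {α : Type*} (l : List α) (u : α → ℝ≥0∞) (f : α → ℝ) :
    (l.map fun a => u a * ENNReal.ofReal (Real.exp (f a))).prod =
      (l.map u).prod * ENNReal.ofReal (Real.exp (l.map f).sum) := by
  induction l with
  | nil => simp
  | cons a l ih =>
    simp only [List.map_cons, List.prod_cons, List.sum_cons]
    rw [ih, Real.exp_add, ENNReal.ofReal_mul (Real.exp_pos _).le]
    ring

lemma tiltedKernel_eq (hp : IsCriticalOffspring p) (hQ : IsIrreducibleKernel Q)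
    (g : 𝒳 → 𝒳 → ℝ) (b : 𝒳) (l : List 𝒳) :
    tiltedKernel p Q g b l = tiltedKernel p Q 0 b l *
      ENNReal.ofReal (Real.exp ((l.map (g b)).sum - vertexCost p Q g b)) := by
  rw [tiltedKernel, tiltedKernel, vertexCost_zero hp hQ]
  have h := list_prod_map_mul_ofReal_exp l (fun c => ENNReal.ofReal (Q b c)) (g b)
  simp_rw [← ENNReal.ofReal_mul (hQ.nonneg b _)] at h
  rw [h, sub_eq_add_neg, Real.exp_add, ENNReal.ofReal_mul (Real.exp_pos _).le]
  simp only [Pi.zero_apply, Real.exp_zero, mul_one, neg_zero, ENNReal.ofReal_one]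
  ring

end Kernel

namespace PTree

variable {p : ℕ → ℝ} {Q : 𝒳 → 𝒳 → ℝ}

lemma sum_pairCount_node_mul (a : 𝒳) (ts : List (PTree 𝒳)) (h : 𝒳 × 𝒳 → ℝ) :
    ∑ x : 𝒳 × 𝒳, (pairCount (node a ts) x.1 x.2 : ℝ) * h x =
      (ts.map fun s => h (a, s.root) + ∑ x : 𝒳 × 𝒳, (pairCount s x.1 x.2 : ℝ) * h x).sum := by
  simp_rw [pairCount_node]
  induction ts with
  | nil => simp
  | cons s ts ih =>
    simp only [List.map_cons, List.sum_cons]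
    rw [← ih]
    have h1 : h (a, s.root) = ∑ x : 𝒳 × 𝒳, (if x = (a, s.root) then 1 else 0) * h x := by simp
    rw [h1, ← Finset.sum_add_distrib, ← Finset.sum_add_distrib]
    refine Finset.sum_congr rfl fun x _ => ?_
    rw [List.count_cons]
    obtain ⟨b, c⟩ := x
    have hx : (b, c) = (a, s.root) ↔ a = b ∧ s.root = c := by
      rw [Prod.ext_iff, eq_comm (a := a), eq_comm (a := s.root)]
    simp only [hx]
    by_cases hb : a = b <;> by_cases hc : s.root = c <;> simp [hb, hc] <;> ring

lemma weight_tiltedKernel (hp : IsCriticalOffspring p) (hQ : IsIrreducibleKernel Q)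
    (g : 𝒳 → 𝒳 → ℝ) (t : PTree 𝒳) :
    weight (tiltedKernel p Q g) t = weight (tiltedKernel p Q 0) t * ENNReal.ofReal (Real.exp
      (∑ x : 𝒳 × 𝒳, (pairCount t x.1 x.2 : ℝ) * (g x.1 x.2 - vertexCost p Q g x.2) -
        vertexCost p Q g t.root)) := by
  induction t using induction_on with
  | h a ts ih =>
    rw [weight_node, List.map_congr_left ih, list_prod_map_mul_ofReal_exp, weight_node,
      tiltedKernel_eq hp hQ g, mul_mul_mul_comm, ← ENNReal.ofReal_mul (Real.exp_pos _).le,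
      ← Real.exp_add, sum_pairCount_node_mul a ts fun x => g x.1 x.2 - vertexCost p Q g x.2]
    congr 3
    rw [List.map_map, root, sub_add_eq_add_sub, ← List.sum_map_add]
    congr 3
    funext s
    simp only [Function.comp]
    ring

lemma pairCount_eq_mul_empPair (t : PTree 𝒳) (x : 𝒳 × 𝒳) :
    (pairCount t x.1 x.2 : ℝ) = ((t.size : ℝ) - 1) * empPair t x := by
  rcases eq_or_ne ((t.size : ℝ) - 1) 0 with h | h
  · have h1 : t.size = 1 := by exact_mod_cast sub_eq_zero.1 h
    have := pairCount_lt_size t x.1 x.2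
    rw [h, zero_mul, Nat.cast_eq_zero]
    omega
  · rw [empPair, mul_div_cancel₀ _ h]

lemma sum_pairCount_mul (g : 𝒳 → 𝒳 → ℝ) (t : PTree 𝒳) :
    ∑ x : 𝒳 × 𝒳, (pairCount t x.1 x.2 : ℝ) * (g x.1 x.2 - vertexCost p Q g x.2) =
      ((t.size : ℝ) - 1) * dualFn p Q g (empPair t) := by
  rw [dualFn, Finset.mul_sum]
  exact Finset.sum_congr rfl fun x _ => by rw [pairCount_eq_mul_empPair]; ring

lemma isProbVec_empPair (t : PTree 𝒳) (ht : 2 ≤ t.size) : IsProbVec (empPair t) := by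
  have h : (0 : ℝ) < (t.size : ℝ) - 1 := by
    have : (2 : ℝ) ≤ t.size := by exact_mod_cast ht
    linarith
  refine ⟨fun x => div_nonneg (Nat.cast_nonneg _) h.le, ?_⟩
  simp_rw [empPair]
  rw [← Finset.sum_div, div_eq_one_iff_eq h.ne', ← sum_pairCount t]
  push_cast
  ring

lemma weight_tiltedKernel_eq_mul (hp : IsCriticalOffspring p) (hQ : IsIrreducibleKernel Q)
    (g g' : 𝒳 → 𝒳 → ℝ) (t : PTree 𝒳) :
    weight (tiltedKernel p Q g) t = weight (tiltedKernel p Q g') t * ENNReal.ofReal (Real.exp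
      (((t.size : ℝ) - 1) * (dualFn p Q g (empPair t) - dualFn p Q g' (empPair t)) +
        (vertexCost p Q g' t.root - vertexCost p Q g t.root))) := by
  rw [weight_tiltedKernel hp hQ g, weight_tiltedKernel hp hQ g', mul_assoc,
    ← ENNReal.ofReal_mul (Real.exp_pos _).le, ← Real.exp_add, sum_pairCount_mul, sum_pairCount_mul]
  congr 3
  ring

lemma ofReal_jointWeight (hp : IsCriticalOffspring p) (hQ : IsIrreducibleKernel Q) {μ0 : 𝒳 → ℝ}
    (hμ0 : ∀ a, 0 ≤ μ0 a) (t : PTree 𝒳) :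
    ENNReal.ofReal (jointWeight p μ0 Q t) =
      ENNReal.ofReal (μ0 t.root) * weight (tiltedKernel p Q 0) t := by
  have hprod : ∀ s : PTree 𝒳, 0 ≤ (s.children.map fun c => Q s.root c.root).prod := fun s =>
    List.prod_nonneg fun x hx => by
      obtain ⟨c, -, rfl⟩ := List.mem_map.1 hx
      exact hQ.nonneg _ _
  rw [jointWeight, ENNReal.ofReal_mul (hμ0 _), ENNReal.ofReal_list_prod_map, weight]
  · congr 2
    refine List.map_congr_left fun s _ => ?_
    rw [tiltedKernel_zero hp hQ, childLabels, List.length_map, List.map_map]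
    rfl
  · exact fun s => mul_nonneg (hp.nonneg _) (hprod s)

/-- If some `dualFn p Q g` exceeds `dualFn p Q g₀` by more than `α` at each point of the compact set
`F`, then trees with empirical pair measure in `F` have weight `O(exp (-α n))`. -/
lemma exists_tsum_weight_le (hp : IsCriticalOffspring p) (hQ : IsIrreducibleKernel Q)
    (g₀ : 𝒳 → 𝒳 → ℝ) {F : Set (𝒳 × 𝒳 → ℝ)} (hF : IsCompact F) {α : ℝ}
    (h : ∀ ν ∈ F, ∃ g, α < dualFn p Q g ν - dualFn p Q g₀ ν) :
    ∃ B : ℝ≥0∞, B ≠ ∞ ∧ ∀ (n : ℕ) (P : PTree 𝒳 → Prop) [DecidablePred P],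
      (∀ t, P t → t.size = n + 1 ∧ empPair t ∈ F) →
      ∑' t : PTree 𝒳, (if P t then weight (tiltedKernel p Q g₀) t else 0) ≤
        B * ENNReal.ofReal (Real.exp (-α * n)) := by
  classical
  have hopen : ∀ g, IsOpen {ν | α < dualFn p Q g ν - dualFn p Q g₀ ν} := fun g =>
    isOpen_lt continuous_const ((continuous_dualFn p Q g).sub (continuous_dualFn p Q g₀))
  obtain ⟨s, hs⟩ := hF.elim_finite_subcover _ hopen fun ν hν => by
    obtain ⟨g, hg⟩ := h ν hν
    exact Set.mem_iUnion.2 ⟨g, hg⟩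
  let b : (𝒳 → 𝒳 → ℝ) → ℝ≥0∞ := fun g =>
    ∑ c, ENNReal.ofReal (Real.exp (vertexCost p Q g c - vertexCost p Q g₀ c))
  refine ⟨∑ g ∈ s, b g * Fintype.card 𝒳, ENNReal.sum_ne_top.2 fun g _ => ENNReal.mul_ne_top
    (ENNReal.sum_ne_top.2 fun c _ => ENNReal.ofReal_ne_top) (ENNReal.natCast_ne_top _), ?_⟩
  intro n P _ hP
  calc ∑' t : PTree 𝒳, (if P t then weight (tiltedKernel p Q g₀) t else 0)
      ≤ ∑' t : PTree 𝒳, ∑ g ∈ s,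
          weight (tiltedKernel p Q g) t * (b g * ENNReal.ofReal (Real.exp (-α * n))) := by
        refine ENNReal.tsum_le_tsum fun t => ?_
        split_ifs with ht
        swap
        · exact zero_le
        obtain ⟨hn, htF⟩ := hP t ht
        obtain ⟨g, hgs, hg⟩ := Set.mem_iUnion₂.1 (hs htF)
        refine le_trans ?_ (Finset.single_le_sum (fun _ _ => zero_le) hgs)
        rw [weight_tiltedKernel_eq_mul hp hQ g₀ g]
        refine mul_le_mul_right ?_ _
        rw [hn, Nat.cast_add_one, add_sub_cancel_right, Real.exp_add,
          ENNReal.ofReal_mul (Real.exp_pos _).le, mul_comm]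
        refine mul_le_mul' ?_ (ENNReal.ofReal_le_ofReal (Real.exp_le_exp.2 ?_))
        · exact Finset.single_le_sum (f := fun c => ENNReal.ofReal
            (Real.exp (vertexCost p Q g c - vertexCost p Q g₀ c))) (fun _ _ => zero_le)
            (Finset.mem_univ t.root)
        · have hg' : α < dualFn p Q g (empPair t) - dualFn p Q g₀ (empPair t) := hg
          nlinarith [Nat.cast_nonneg (α := ℝ) n]
    _ = ∑ g ∈ s, (∑' t, weight (tiltedKernel p Q g) t) *
          (b g * ENNReal.ofReal (Real.exp (-α * n))) := by
        rw [Summable.tsum_finsetSum fun _ _ => ENNReal.summable]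
        simp_rw [ENNReal.tsum_mul_right]
    _ ≤ ∑ g ∈ s, (Fintype.card 𝒳 : ℝ≥0∞) * (b g * ENNReal.ofReal (Real.exp (-α * n))) := by
        refine Finset.sum_le_sum fun g _ => mul_le_mul_left ?_ _
        exact tsum_weight_le fun b => (tsum_tiltedKernel hp hQ g b).le
    _ = _ := by
        rw [Finset.sum_mul]
        exact Finset.sum_congr rfl fun g _ => by ring

end PTree

section Regular

variable {p : ℕ → ℝ} {Q : 𝒳 → 𝒳 → ℝ} {μ : 𝒳 × 𝒳 → ℝ}

namespace IsIrreducibleKernel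

lemma forall_of_backward (hQ : IsIrreducibleKernel Q) {P : 𝒳 → Prop}
    (hP : ∀ b c, P c → 0 < Q b c → P b) {c : 𝒳} (hc : P c) (b : 𝒳) : P b := by
  have h : ∀ (k : ℕ) (b : 𝒳), ((Matrix.of Q) ^ k) b c ≠ 0 → P b := by
    intro k
    induction k with
    | zero =>
      intro b hb
      rw [pow_zero, Matrix.one_apply] at hb
      have : b = c := by_contra fun h => hb (if_neg h)
      rwa [this]
    | succ k ih =>
      intro b hb
      rw [pow_succ', Matrix.mul_apply] at hb
      obtain ⟨d, -, hd⟩ := Finset.exists_ne_zero_of_sum_ne_zero hb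
      exact hP b d (ih d (right_ne_zero_of_mul hd))
        ((hQ.nonneg b d).lt_of_ne' (left_ne_zero_of_mul hd))
  obtain ⟨k, hk⟩ := hQ.irreducible b c
  exact h _ b hk.ne'

lemma exists_pred (hQ : IsIrreducibleKernel Q) (c : 𝒳) : ∃ b, 0 < Q b c := by
  obtain ⟨k, hk⟩ := hQ.irreducible c c
  rw [pow_succ, Matrix.mul_apply] at hk
  obtain ⟨b, -, hb⟩ := Finset.exists_ne_zero_of_sum_ne_zero hk.ne'
  exact ⟨b, (hQ.nonneg b c).lt_of_ne' (right_ne_zero_of_mul hb)⟩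

lemma exists_succ (hQ : IsIrreducibleKernel Q) (b : 𝒳) : ∃ c, 0 < Q b c := by
  by_contra! h
  have h1 := hQ.sum_eq_one b
  rw [Finset.sum_eq_zero fun c _ => le_antisymm (h c) (hQ.nonneg b c)] at h1
  exact zero_ne_one h1

/-- A nonnegative left eigenvector with a zero entry vanishes. -/
lemma eq_zero_of_invariant (hQ : IsIrreducibleKernel Q) {m : 𝒳 → 𝒳 → ℝ} (hm : ∀ b c, 0 ≤ m b c)
    (hmQ : ∀ b c, 0 < Q b c → 0 < m b c) {v : 𝒳 → ℝ} (hv : ∀ b, 0 ≤ v b)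
    (hinv : ∀ c, ∑ b, v b * m b c = v c) {c : 𝒳} (hc : v c = 0) (b : 𝒳) : v b = 0 := by
  refine hQ.forall_of_backward (P := fun b => v b = 0) (fun b c hc hbc => ?_) hc b
  have h := hinv c
  rw [hc, Finset.sum_eq_zero_iff_of_nonneg fun b _ => mul_nonneg (hv b) (hm b c)] at h
  exact (mul_eq_zero.1 (h b (Finset.mem_univ b))).resolve_right (hmQ b c hbc).ne'

lemma eq_of_invariant (hQ : IsIrreducibleKernel Q) {m : 𝒳 → 𝒳 → ℝ} (hm : ∀ b c, 0 ≤ m b c)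
    (hmQ : ∀ b c, 0 < Q b c → 0 < m b c) {u v : 𝒳 → ℝ} (hu : ∀ b, 0 < u b)
    (huinv : ∀ c, ∑ b, u b * m b c = u c)
    (hvinv : ∀ c, ∑ b, v b * m b c = v c) (hsum : ∑ b, u b = ∑ b, v b) : v = u := by
  rcases isEmpty_or_nonempty 𝒳 with h | h
  · exact funext fun b => h.elim b
  obtain ⟨c, hc⟩ := Finite.exists_min fun b => v b / u b
  set r := v c / u c with hr
  have hw := hQ.eq_zero_of_invariant hm hmQ (v := fun b => v b - r * u b) (c := c)
    (fun b => sub_nonneg.2 ((le_div_iff₀ (hu b)).1 (hc b)))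
    (fun d => by
      simp_rw [sub_mul, mul_assoc]
      rw [Finset.sum_sub_distrib, ← Finset.mul_sum, huinv, hvinv])
    (by rw [hr, div_mul_cancel₀ _ (hu c).ne', sub_self])
  have hvr : ∀ b, v b = r * u b := fun b => sub_eq_zero.1 (hw b)
  have hpos : 0 < ∑ b, u b := Finset.sum_pos (fun b _ => hu b) Finset.univ_nonempty
  have hr1 : r = 1 := by
    simp_rw [hvr, ← Finset.mul_sum] at hsum
    exact (mul_right_cancel₀ hpos.ne' (by rw [one_mul]; exact hsum)).symm
  funext b
  rw [hvr, hr1, one_mul]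

lemma exists_stationary [Nonempty 𝒳] (hQ : IsIrreducibleKernel Q) :
    ∃ π : 𝒳 → ℝ, (∀ b, 0 < π b) ∧ ∑ b, π b = 1 ∧ ∀ c, ∑ b, π b * Q b c = π c := by
  have hdet : (Matrix.of Q - 1).det = 0 := by
    refine Matrix.exists_mulVec_eq_zero_iff.1 ⟨fun _ => 1, ?_, ?_⟩
    · intro h
      exact one_ne_zero (congrFun h (Classical.arbitrary 𝒳))
    · funext b
      rw [Matrix.sub_mulVec, Matrix.one_mulVec]
      simp [Matrix.mulVec, dotProduct, hQ.sum_eq_one]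
  obtain ⟨v, hv0, hv⟩ := Matrix.exists_vecMul_eq_zero_iff.2 hdet
  have hvinv : ∀ c, ∑ b, v b * Q b c = v c := fun c => by
    have := congrFun hv c
    rw [Matrix.vecMul_sub, Matrix.vecMul_one] at this
    exact sub_eq_zero.1 this
  have hle : ∀ c, |v c| ≤ ∑ b, |v b| * Q b c := fun c => by
    conv_lhs => rw [← hvinv c]
    refine (Finset.abs_sum_le_sum_abs _ _).trans (Finset.sum_le_sum fun b _ => ?_)
    rw [abs_mul, abs_of_nonneg (hQ.nonneg b c)]
  have hsum : ∑ c, |v c| = ∑ c, ∑ b, |v b| * Q b c := by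
    rw [Finset.sum_comm]
    simp_rw [← Finset.mul_sum, hQ.sum_eq_one, mul_one]
  have hinv : ∀ c, ∑ b, |v b| * Q b c = |v c| := fun c =>
    ((Finset.sum_eq_sum_iff_of_le fun c _ => hle c).1 hsum c (Finset.mem_univ c)).symm
  have hpos : ∀ b, 0 < |v b| := fun b => by
    refine (abs_nonneg _).lt_of_ne' fun hb => hv0 (funext fun c => ?_)
    exact abs_eq_zero.1 (hQ.eq_zero_of_invariant hQ.nonneg (fun _ _ h => h)
      (fun b => abs_nonneg (v b)) hinv hb c)
  have hs : 0 < ∑ b, |v b| := Finset.sum_pos (fun b _ => hpos b) Finset.univ_nonempty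
  refine ⟨fun b => |v b| / ∑ b, |v b|, fun b => div_pos (hpos b) hs, ?_, fun c => ?_⟩
  · rw [← Finset.sum_div, div_self hs.ne']
  · simp_rw [div_mul_eq_mul_div]
    rw [← Finset.sum_div, hinv]

/-- The Green function of a nonnegative matrix with a finite left eigenvector of eigenvalue one is
infinite on the diagonal. -/
lemma tsum_pow_eq_top (hQ : IsIrreducibleKernel Q) {M : Matrix 𝒳 𝒳 ℝ≥0∞}
    (hM : ∀ b c, 0 < Q b c → M b c ≠ 0) {v : 𝒳 → ℝ≥0∞} (hv : ∀ b, v b ≠ ∞)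
    (hinv : ∀ c, ∑ b, v b * M b c = v c) {a : 𝒳} (ha : v a ≠ 0) :
    ∑' h : ℕ, (M ^ h) a a = ∞ := by
  have hpow : ∀ (h : ℕ) (c : 𝒳), ∑ b, v b * (M ^ h) b c = v c := by
    intro h
    induction h with
    | zero => intro c; simp [Matrix.one_apply]
    | succ h ih =>
      intro c
      simp_rw [pow_succ, Matrix.mul_apply, Finset.mul_sum]
      rw [Finset.sum_comm, ← hinv c]
      refine Finset.sum_congr rfl fun d _ => ?_
      rw [← ih d, Finset.sum_mul]
      exact Finset.sum_congr rfl fun b _ => by rw [mul_assoc]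
  have htop : ∑ b, v b * ∑' h : ℕ, (M ^ h) b a = ∞ := by
    simp_rw [← ENNReal.tsum_mul_left]
    rw [← Summable.tsum_finsetSum fun _ _ => ENNReal.summable]
    simp_rw [hpow]
    exact ENNReal.tsum_const_eq_top_of_ne_zero ha
  obtain ⟨b, -, hb⟩ := ENNReal.sum_eq_top.1 htop
  have hb' : ∑' h : ℕ, (M ^ h) b a = ∞ := by
    rcases ENNReal.mul_eq_top.1 hb with h | h
    · exact h.2
    · exact absurd h.1 (hv b)
  obtain ⟨j, hj⟩ : ∃ j : ℕ, (M ^ j) a b ≠ 0 := by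
    refine hQ.forall_of_backward (P := fun a => ∃ j : ℕ, (M ^ j) a b ≠ 0) ?_
      (c := b) ⟨0, by simp⟩ a
    rintro d c ⟨j, hj⟩ hdc
    refine ⟨j + 1, ?_⟩
    rw [pow_succ', Matrix.mul_apply]
    exact fun h => mul_ne_zero (hM d c hdc) hj
      (Finset.sum_eq_zero_iff.1 h c (Finset.mem_univ c))
  refine top_le_iff.1 ?_
  calc (∞ : ℝ≥0∞) = ∑' h : ℕ, (M ^ j) a b * (M ^ h) b a := by
        rw [ENNReal.tsum_mul_left, hb', ENNReal.mul_top hj]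
    _ ≤ ∑' h : ℕ, (M ^ (j + h)) a a := by
        refine ENNReal.tsum_le_tsum fun h => ?_
        rw [pow_add, Matrix.mul_apply]
        exact Finset.single_le_sum (f := fun b => (M ^ j) a b * (M ^ h) b a)
          (fun _ _ => zero_le) (Finset.mem_univ b)
    _ ≤ _ := ENNReal.tsum_comp_le_tsum_of_injective (add_right_injective j) fun h => (M ^ h) a a

end IsIrreducibleKernel

/-- Pair measures which are the typical pair measure under some exponential tilt. -/
structure IsRegularPair (p : ℕ → ℝ) (Q : 𝒳 → 𝒳 → ℝ) (μ : 𝒳 × 𝒳 → ℝ) : Prop where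
  isProbVec : IsProbVec μ
  pos_iff : ∀ b c, 0 < μ (b, c) ↔ 0 < Q b c
  fst_lt : ∃ k, 0 < p k ∧ ∀ b, ∑ c, μ (b, c) < k * ∑ a, μ (a, b)

namespace IsRegularPair

lemma fst_pos (hμ : IsRegularPair p Q μ) (hQ : IsIrreducibleKernel Q) (b : 𝒳) :
    0 < ∑ c, μ (b, c) := by
  obtain ⟨c, hc⟩ := hQ.exists_succ b
  exact Finset.sum_pos' (fun c _ => hμ.isProbVec.1 _) ⟨c, Finset.mem_univ c, (hμ.pos_iff b c).2 hc⟩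

lemma snd_pos (hμ : IsRegularPair p Q μ) (hQ : IsIrreducibleKernel Q) (c : 𝒳) :
    0 < ∑ b, μ (b, c) := by
  obtain ⟨b, hb⟩ := hQ.exists_pred c
  exact Finset.sum_pos' (fun b _ => hμ.isProbVec.1 _) ⟨b, Finset.mem_univ b, (hμ.pos_iff b c).2 hb⟩

lemma exists_tilt (hμ : IsRegularPair p Q μ) (hp : IsCriticalOffspring p)
    (hQ : IsIrreducibleKernel Q) :
    ∃ g : 𝒳 → 𝒳 → ℝ, ∀ b c, tiltedMean p Q g b c = μ (b, c) / ∑ a, μ (a, b) := by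
  obtain ⟨k, hk, hlt⟩ := hμ.fst_lt
  have h1 := hμ.fst_pos hQ
  have h2 := hμ.snd_pos hQ
  choose lam hlam using fun b => hp.exists_mgfDeriv_eq (div_pos (h1 b) (h2 b)) hk
    ((div_lt_iff₀ (h2 b)).2 (hlt b))
  let g : 𝒳 → 𝒳 → ℝ := fun b c => lam b + Real.log (μ (b, c) / ((∑ c, μ (b, c)) * Q b c))
  have hg : ∀ b c, Q b c * Real.exp (g b c) = Real.exp (lam b) * (μ (b, c) / ∑ c, μ (b, c)) := by
    intro b c
    rcases (hQ.nonneg b c).eq_or_lt with h0 | h0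
    · have : μ (b, c) = 0 := le_antisymm
        (not_lt.1 fun h => ((hμ.pos_iff b c).1 h).ne h0) (hμ.isProbVec.1 _)
      simp [← h0, this]
    · rw [Real.exp_add, Real.exp_log (div_pos ((hμ.pos_iff b c).2 h0) (mul_pos (h1 b) h0))]
      have := (h1 b).ne'
      field_simp
  have hlog : ∀ b, logTilt Q g b = lam b := by
    intro b
    rw [logTilt]
    simp_rw [hg]
    rw [← Finset.mul_sum, ← Finset.sum_div, div_self (h1 b).ne', mul_one, Real.log_exp]
  refine ⟨g, fun b c => ?_⟩
  rw [tiltedMean, hg, hlog, hlam, mul_div_cancel_right₀ _ (hp.mgf_pos _).ne',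
    mul_div_cancel_left₀ _ (Real.exp_pos _).ne', div_mul_div_cancel₀ (h1 b).ne']

end IsRegularPair

lemma hasDerivAt_dualFn (hp : IsCriticalOffspring p) (hQ : IsIrreducibleKernel Q)
    (g e : 𝒳 → 𝒳 → ℝ) (ν : 𝒳 × 𝒳 → ℝ) :
    HasDerivAt (fun s : ℝ => dualFn p Q (fun b c => g b c + s * e b c) ν)
      (∑ x : 𝒳 × 𝒳, ν x * (e x.1 x.2 - ∑ c, tiltedMean p Q g x.2 c * e x.2 c)) 0 := by
  have hlin : ∀ b c, HasDerivAt (fun s : ℝ => g b c + s * e b c) (e b c) 0 := fun b c => by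
    simpa using ((hasDerivAt_id (0 : ℝ)).mul_const (e b c)).const_add (g b c)
  have hlog : ∀ b, HasDerivAt (fun s : ℝ => logTilt Q (fun b c => g b c + s * e b c) b)
      ((∑ c, Q b c * (Real.exp (g b c) * e b c)) / Real.exp (logTilt Q g b)) 0 := by
    intro b
    have h1 : HasDerivAt (fun s : ℝ => ∑ c, Q b c * Real.exp (g b c + s * e b c))
        (∑ c, Q b c * (Real.exp (g b c) * e b c)) 0 := by
      refine HasDerivAt.fun_sum fun c _ => ?_
      simpa using ((hlin b c).exp.const_mul (Q b c))
    have h2 := h1.log (hQ.tiltMass_pos (fun b c => g b c + (0 : ℝ) * e b c) b).ne'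
    rw [hQ.exp_logTilt]
    simp only [zero_mul, add_zero] at h2
    exact h2
  have hV : ∀ b, HasDerivAt (fun s : ℝ => vertexCost p Q (fun b c => g b c + s * e b c) b)
      (∑ c, tiltedMean p Q g b c * e b c) 0 := by
    intro b
    have h0 : logTilt Q (fun b c => g b c + (0 : ℝ) * e b c) b = logTilt Q g b := by simp
    have h1 := hp.hasDerivAt_log_mgf (logTilt Q (fun b c => g b c + (0 : ℝ) * e b c) b)
    have h2 := h1.comp 0 (hlog b)
    rw [h0] at h2
    have hval : ∑ c, tiltedMean p Q g b c * e b c =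
        offspringMgfDeriv p (logTilt Q g b) / offspringMgf p (logTilt Q g b) *
          ((∑ c, Q b c * (Real.exp (g b c) * e b c)) / Real.exp (logTilt Q g b)) := by
      rw [Finset.sum_div, Finset.mul_sum]
      refine Finset.sum_congr rfl fun c _ => ?_
      rw [tiltedMean]
      ring
    rw [hval]
    exact h2
  exact HasDerivAt.fun_sum fun x _ => ((hlin x.1 x.2).sub (hV x.2)).const_mul (ν x)

lemma exists_dualFn_lt (hp : IsCriticalOffspring p) (hQ : IsIrreducibleKernel Q)
    (g : 𝒳 → 𝒳 → ℝ) {ν : 𝒳 × 𝒳 → ℝ} {b c : 𝒳}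
    (h : ν (b, c) ≠ (∑ a, ν (a, b)) * tiltedMean p Q g b c) :
    ∃ g', dualFn p Q g ν < dualFn p Q g' ν := by
  by_contra! hmax
  let e : 𝒳 → 𝒳 → ℝ := fun b c => ν (b, c) - (∑ a, ν (a, b)) * tiltedMean p Q g b c
  have hloc : IsLocalMax (fun s : ℝ => dualFn p Q (fun b c => g b c + s * e b c) ν) 0 :=
    Eventually.of_forall fun s => by simpa using hmax fun b c => g b c + s * e b c
  have h0 := hloc.hasDerivAt_eq_zero (hasDerivAt_dualFn hp hQ g e ν)
  have h1 : ∑ x : 𝒳 × 𝒳, ν x * (e x.1 x.2 - ∑ c, tiltedMean p Q g x.2 c * e x.2 c) =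
      ∑ x : 𝒳 × 𝒳, e x.1 x.2 * e x.1 x.2 := by
    simp_rw [mul_sub]
    rw [Finset.sum_sub_distrib,
      sum_prod_mul_snd ν fun b => ∑ c, tiltedMean p Q g b c * e b c]
    simp_rw [Finset.mul_sum]
    rw [← Fintype.sum_prod_type' fun b c => (∑ a, ν (a, b)) * (tiltedMean p Q g b c * e b c),
      ← Finset.sum_sub_distrib]
    refine Finset.sum_congr rfl fun x _ => ?_
    simp only [e]
    ring
  rw [h1, Finset.sum_eq_zero_iff_of_nonneg fun x _ => mul_self_nonneg _] at h0
  exact h (sub_eq_zero.1 (mul_self_eq_zero.1 (h0 (b, c) (Finset.mem_univ _))))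

lemma isCompact_isProbVec : IsCompact {ν : 𝒳 × 𝒳 → ℝ | IsProbVec ν} :=
  isCompact_stdSimplex ℝ (𝒳 × 𝒳)

lemma exists_uniform_gap (g : 𝒳 → 𝒳 → ℝ) {F : Set (𝒳 × 𝒳 → ℝ)} (hF : IsCompact F)
    (h : ∀ ν ∈ F, ∃ g', dualFn p Q g ν < dualFn p Q g' ν) :
    ∃ α : ℝ, 0 < α ∧ ∀ ν ∈ F, ∃ g', α < dualFn p Q g' ν - dualFn p Q g ν := by
  let U : ℕ → Set (𝒳 × 𝒳 → ℝ) := fun k =>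
    {ν | ∃ g', (1 : ℝ) / (k + 1) < dualFn p Q g' ν - dualFn p Q g ν}
  obtain ⟨k, hk⟩ := hF.elim_directed_cover U
    (fun k => by
      have : U k = ⋃ g', {ν | (1 : ℝ) / (k + 1) < dualFn p Q g' ν - dualFn p Q g ν} := by
        ext ν; simp [U]
      rw [this]
      exact isOpen_iUnion fun g' => isOpen_lt continuous_const
        ((continuous_dualFn p Q g').sub (continuous_dualFn p Q g)))
    (fun ν hν => by
      obtain ⟨g', hg'⟩ := h ν hν
      obtain ⟨k, hk⟩ := exists_nat_one_div_lt (sub_pos.2 hg')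
      exact Set.mem_iUnion.2 ⟨k, g', hk⟩)
    (directed_of_isDirected_le fun i j hij ν ⟨g', hg'⟩ =>
      ⟨g', (one_div_le_one_div_of_le (by positivity) (by gcongr)).trans_lt hg'⟩)
  exact ⟨1 / (k + 1), by positivity, fun ν hν => hk hν⟩

namespace IsRegularPair

lemma tiltedMean_invariant (hμ : IsRegularPair p Q μ) (hQ : IsIrreducibleKernel Q)
    {g : 𝒳 → 𝒳 → ℝ} (hg : ∀ b c, tiltedMean p Q g b c = μ (b, c) / ∑ a, μ (a, b)) (c : 𝒳) :
    ∑ b, (∑ a, μ (a, b)) * tiltedMean p Q g b c = ∑ a, μ (a, c) :=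
  Finset.sum_congr rfl fun b _ => by rw [hg, mul_div_cancel₀ _ (hμ.snd_pos hQ b).ne']

lemma exists_dualFn_lt_of_ne (hμ : IsRegularPair p Q μ) (hp : IsCriticalOffspring p)
    (hQ : IsIrreducibleKernel Q) {g : 𝒳 → 𝒳 → ℝ}
    (hg : ∀ b c, tiltedMean p Q g b c = μ (b, c) / ∑ a, μ (a, b)) {ν : 𝒳 × 𝒳 → ℝ}
    (hν : IsProbVec ν) (hne : ν ≠ μ) : ∃ g', dualFn p Q g ν < dualFn p Q g' ν := by
  by_contra hcon
  have h : ∀ b c, ν (b, c) = (∑ a, ν (a, b)) * tiltedMean p Q g b c := fun b c =>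
    by_contra fun h => hcon (exists_dualFn_lt hp hQ g h)
  have hsum : ∀ {ρ : 𝒳 × 𝒳 → ℝ}, IsProbVec ρ → ∑ b, ∑ a, ρ (a, b) = 1 := fun hρ => by
    rw [← hρ.2, Fintype.sum_prod_type, Finset.sum_comm]
  have heq := hQ.eq_of_invariant (m := tiltedMean p Q g) (u := fun b => ∑ a, μ (a, b))
    (v := fun b => ∑ a, ν (a, b))
    (fun b c => by rw [hg]; exact div_nonneg (hμ.isProbVec.1 _) (hμ.snd_pos hQ b).le)
    (fun b c hbc => by rw [hg]; exact div_pos ((hμ.pos_iff b c).2 hbc) (hμ.snd_pos hQ b))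
    (hμ.snd_pos hQ) (hμ.tiltedMean_invariant hQ hg)
    (fun c => Finset.sum_congr rfl fun b _ => (h b c).symm)
    (by rw [hsum hμ.isProbVec, hsum hν])
  refine hne (funext fun x => ?_)
  obtain ⟨b, c⟩ := x
  rw [h, hg, congrFun heq b, mul_div_cancel₀ _ (hμ.snd_pos hQ b).ne']

lemma concentrates (hμ : IsRegularPair p Q μ) (hp : IsCriticalOffspring p)
    (hQ : IsIrreducibleKernel Q) {g : 𝒳 → 𝒳 → ℝ}
    (hg : ∀ b c, tiltedMean p Q g b c = μ (b, c) / ∑ a, μ (a, b)) {ε : ℝ} (hε : 0 < ε) :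
    PTree.Concentrates (tiltedKernel p Q g) μ ε := by
  classical
  let F : Set (𝒳 × 𝒳 → ℝ) := {ν | IsProbVec ν} ∩ ⋃ x, {ν | ε ≤ |ν x - μ x|}
  have hF : IsCompact F := by
    refine isCompact_isProbVec.inter_right (isClosed_iUnion_of_finite fun x => ?_)
    exact isClosed_le continuous_const (((continuous_apply x).sub continuous_const).abs)
  obtain ⟨α, hα, hgap⟩ := exists_uniform_gap (p := p) (Q := Q) g hF fun ν hν => by
    refine hμ.exists_dualFn_lt_of_ne hp hQ hg hν.1 ?_
    rintro rfl
    obtain ⟨x, hx⟩ := Set.mem_iUnion.1 hν.2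
    have hx' : ε ≤ |ν x - ν x| := hx
    rw [sub_self, abs_zero] at hx'
    exact hx'.not_gt hε
  obtain ⟨B, hB, hbd⟩ := PTree.exists_tsum_weight_le hp hQ g hF hgap
  refine ⟨B, hB, α, hα, fun n => hbd n _ ?_⟩
  rintro t ⟨hn, hnear⟩
  refine ⟨hn, ?_⟩
  have hpc : ∀ x : 𝒳 × 𝒳, (pairCount t x.1 x.2 : ℝ) = n * empPair t x := fun x => by
    rw [PTree.pairCount_eq_mul_empPair, hn]; push_cast; ring
  rw [NearCount] at hnear
  push Not at hnear
  obtain ⟨x, hx⟩ := hnear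
  rw [hpc, ← mul_sub, abs_mul, Nat.abs_cast] at hx
  have hn0 : 0 < n := by
    refine Nat.pos_of_ne_zero ?_
    rintro rfl
    simp at hx
  exact ⟨PTree.isProbVec_empPair t (by omega),
    Set.mem_iUnion.2 ⟨x, (lt_of_mul_lt_mul_left hx (Nat.cast_nonneg n)).le⟩⟩

lemma eventually_le_goodTreeMass (hμ : IsRegularPair p Q μ) (hp : IsCriticalOffspring p)
    (hQ : IsIrreducibleKernel Q) {g : 𝒳 → 𝒳 → ℝ}
    (hg : ∀ b c, tiltedMean p Q g b c = μ (b, c) / ∑ a, μ (a, b)) {ε : ℝ} (hε : 0 < ε) (a : 𝒳)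
    {δ : ℝ} (hδ : 0 < δ) :
    ∀ᶠ n : ℕ in atTop, (∃ t : PTree 𝒳, t.size = n ∧ t.root = a ∧
        PTree.weight (tiltedKernel p Q g) t ≠ 0) →
      ENNReal.ofReal (Real.exp (-δ * n)) ≤
        PTree.goodTreeMass (tiltedKernel p Q g) μ (2 * ε) a n := by
  let v : 𝒳 → ℝ≥0∞ := fun b => ENNReal.ofReal (∑ a, μ (a, b))
  have hv : ∀ b, v b ≠ ∞ := fun b => ENNReal.ofReal_ne_top
  have hv0 : ∀ b, v b ≠ 0 := fun b => (ENNReal.ofReal_pos.2 (hμ.snd_pos hQ b)).ne'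
  have hinv : ∀ c, ∑ b, v b * PTree.meanMatrix (tiltedKernel p Q g) b c = v c := fun c => by
    simp_rw [v, meanMatrix_tiltedKernel hp hQ, ← ENNReal.ofReal_mul (hμ.snd_pos hQ _).le]
    rw [← ENNReal.ofReal_sum_of_nonneg, hμ.tiltedMean_invariant hQ hg]
    intro b _
    rw [hg]
    exact mul_nonneg (hμ.snd_pos hQ b).le (div_nonneg (hμ.isProbVec.1 _) (hμ.snd_pos hQ b).le)
  have hK : ∀ b l, p (List.length l) ≠ 0 → (∀ c ∈ l, 0 < Q b c) → tiltedKernel p Q g b l ≠ 0 := by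
    intro b l hpl hl
    refine mul_ne_zero (mul_ne_zero ?_ ?_) (ENNReal.ofReal_pos.2 (Real.exp_pos _)).ne'
    · exact (ENNReal.ofReal_pos.2 ((hp.nonneg _).lt_of_ne' hpl)).ne'
    · rw [ne_eq, List.prod_eq_zero_iff, List.mem_map]
      rintro ⟨c, hc, h0⟩
      exact (ENNReal.ofReal_pos.2 (mul_pos (hl c hc) (Real.exp_pos _))).ne' h0
  obtain ⟨k, hk, hpk⟩ := hp.exists_two_le
  refine PTree.eventually_le_goodTreeMass (fun c => ?_) (fun x => ⟨hμ.isProbVec.1 x, ?_⟩) hε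
    (hQ.tsum_pow_eq_top (fun b c hbc => ?_) hv hinv (hv0 a)) (hK a [] hp.zero_pos.ne' (by simp))
    (hμ.concentrates hp hQ hg hε) hδ
  · obtain ⟨b, hb⟩ := hQ.exists_pred c
    refine PTree.mass_eq_one (tsum_tiltedKernel hp hQ g) hv hinv hk (hv0 b) (hK b _ ?_ ?_)
    · rw [List.length_replicate]; exact hpk.ne'
    · intro d hd
      rwa [List.eq_of_mem_replicate hd]
  · rw [← hμ.isProbVec.2]
    exact Finset.single_le_sum (fun y _ => hμ.isProbVec.1 y) (Finset.mem_univ x)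
  · rw [meanMatrix_tiltedKernel hp hQ, hg]
    exact (ENNReal.ofReal_pos.2 (div_pos ((hμ.pos_iff b c).2 hbc) (hμ.snd_pos hQ b))).ne'

end IsRegularPair

end Regular

section EventMass

open Classical in
/-- The total weight of the trees with `n` vertices in the event `E`. -/
noncomputable def eventMass (w : PTree 𝒳 → ℝ) (n : ℕ) (E : Set (PTree 𝒳)) : ℝ≥0∞ :=
  ∑' t : PTree 𝒳, if t.size = n ∧ t ∈ E then ENNReal.ofReal (w t) else 0

lemma condP_eq (w : PTree 𝒳 → ℝ) (n : ℕ) (E : Set (PTree 𝒳)) :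
    condP w n E = eventMass w n E / treeMass w n := rfl

lemma eventMass_mono (w : PTree 𝒳 → ℝ) {n : ℕ} {E F : Set (PTree 𝒳)}
    (h : ∀ t : PTree 𝒳, t.size = n → t ∈ E → t ∈ F) : eventMass w n E ≤ eventMass w n F := by
  refine ENNReal.tsum_le_tsum fun t => ?_
  by_cases ht : t.size = n ∧ t ∈ E
  · rw [if_pos ht, if_pos ⟨ht.1, h t ht.1 ht.2⟩]
  · rw [if_neg ht]
    exact zero_le

lemma treeMass_eq_eventMass (w : PTree 𝒳 → ℝ) (n : ℕ) :
    treeMass w n = eventMass w n Set.univ := by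
  simp [treeMass, eventMass]

variable {p : ℕ → ℝ} {Q : 𝒳 → 𝒳 → ℝ} {μ : 𝒳 × 𝒳 → ℝ} {μ0 : 𝒳 → ℝ}

lemma treeMass_jointWeight_le_one (hp : IsCriticalOffspring p) (hQ : IsIrreducibleKernel Q)
    (hμ0 : ∀ a, 0 ≤ μ0 a) (hμ0_sum : ∑ a, μ0 a = 1) (n : ℕ) :
    treeMass (jointWeight p μ0 Q) n ≤ 1 := by
  calc treeMass (jointWeight p μ0 Q) n
      ≤ ∑' t : PTree 𝒳, PTree.weight (tiltedKernel p Q 0) t * ENNReal.ofReal (μ0 t.root) := by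
        refine ENNReal.tsum_le_tsum fun t => ?_
        split_ifs
        · rw [PTree.ofReal_jointWeight hp hQ hμ0, mul_comm]
        · exact zero_le
    _ = ∑ a, PTree.mass (tiltedKernel p Q 0) a * ENNReal.ofReal (μ0 a) := by
        rw [ENNReal.tsum_mul_comp (PTree.root (𝒳 := 𝒳)) (PTree.weight _)
          fun a => ENNReal.ofReal (μ0 a), tsum_fintype]
        rfl
    _ ≤ ∑ a, ENNReal.ofReal (μ0 a) := by
        refine Finset.sum_le_sum fun a _ => mul_le_of_le_one_left zero_le ?_
        exact PTree.mass_le_one (fun b => (tsum_tiltedKernel hp hQ 0 b).le) a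
    _ = 1 := by
        rw [← ENNReal.ofReal_sum_of_nonneg fun a _ => hμ0 a, hμ0_sum, ENNReal.ofReal_one]

lemma dualFn_zero (hp : IsCriticalOffspring p) (hQ : IsIrreducibleKernel Q) (ν : 𝒳 × 𝒳 → ℝ) :
    dualFn p Q 0 ν = 0 :=
  Finset.sum_eq_zero fun x _ => by simp [vertexCost_zero hp hQ]

lemma dualFn_mix (g : 𝒳 → 𝒳 → ℝ) (ν ν' : 𝒳 × 𝒳 → ℝ) (s t : ℝ) :
    dualFn p Q g (fun x => s * ν x + t * ν' x) = s * dualFn p Q g ν + t * dualFn p Q g ν' := by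
  simp_rw [dualFn, Finset.mul_sum]
  rw [← Finset.sum_add_distrib]
  exact Finset.sum_congr rfl fun x _ => by ring

lemma rate_nonneg (hp : IsCriticalOffspring p) (hQ : IsIrreducibleKernel Q) (hμ : IsProbVec μ) :
    0 ≤ rateGWPair p Q μ := by
  have h := dualFn_le_rate p hQ hμ 0
  rwa [dualFn_zero hp hQ] at h

lemma IsRegularPair.eventually_le_eventMass (hμ : IsRegularPair p Q μ) (hp : IsCriticalOffspring p)
    (hQ : IsIrreducibleKernel Q) (hμ0 : ∀ a, 0 ≤ μ0 a) {r : ℝ} (hr : rateGWPair p Q μ < r)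
    {O : Set (𝒳 × 𝒳 → ℝ)} (hO : IsOpen O) (hμO : μ ∈ O) :
    ∀ᶠ n : ℕ in atTop, n ∈ sizeSupport (jointWeight p μ0 Q) →
      ENNReal.ofReal (Real.exp (-r * n)) ≤
        eventMass (jointWeight p μ0 Q) n {t | empPair t ∈ O} := by
  obtain ⟨g, hg⟩ := hμ.exists_tilt hp hQ
  have hD : dualFn p Q g μ < r :=
    EReal.coe_lt_coe_iff.1 ((dualFn_le_rate p hQ hμ.isProbVec g).trans_lt hr)
  obtain ⟨r₀, hr₀, hr₀r⟩ := exists_between hD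
  obtain ⟨δ, hδ, hδr⟩ : ∃ δ, 0 < δ ∧ r = r₀ + δ + δ := ⟨(r - r₀) / 2, by linarith, by ring⟩
  obtain ⟨ρ, hρ, hball⟩ := Metric.isOpen_iff.1
    (hO.inter (isOpen_lt (continuous_dualFn p Q g) continuous_const)) μ ⟨hμO, hr₀⟩
  have hw : ∀ a, 0 < μ0 a → 0 < μ0 a * Real.exp (vertexCost p Q g a + r₀) := fun a ha =>
    mul_pos ha (Real.exp_pos _)
  have hgood : ∀ a, ∀ᶠ n : ℕ in atTop, 0 < μ0 a → (∃ t : PTree 𝒳, t.size = n ∧ t.root = a ∧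
      PTree.weight (tiltedKernel p Q g) t ≠ 0) → ENNReal.ofReal (Real.exp (-r * n)) ≤
        eventMass (jointWeight p μ0 Q) n {t | empPair t ∈ O} := by
    intro a
    by_cases ha : 0 < μ0 a
    swap
    · exact Eventually.of_forall fun n h => absurd h ha
    filter_upwards [hμ.eventually_le_goodTreeMass hp hQ hg (ε := ρ / 4) (by linarith) a hδ,
      PTree.eventually_nat_le_mul_exp (hw a ha) hδ, eventually_ge_atTop 2] with n hn hexp hn2 _ hex
    have hn1 : (0 : ℝ) < (n : ℝ) - 1 := by
      have : (2 : ℝ) ≤ n := by exact_mod_cast hn2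
      linarith
    have hnear_ball : ∀ t : PTree 𝒳, t.size = n → NearCount μ (2 * (ρ / 4)) (n - 1) (pairCount t) →
        empPair t ∈ Metric.ball μ ρ := by
      intro t hsize hnear
      rw [Metric.mem_ball]
      refine lt_of_le_of_lt ((dist_pi_le_iff (by linarith)).2 fun x => ?_)
        (by linarith : 2 * (ρ / 4) < ρ)
      have h := hnear x
      rw [PTree.pairCount_eq_mul_empPair, hsize, Nat.cast_pred (by omega), ← mul_sub, abs_mul,
        abs_of_pos hn1] at h
      exact le_of_mul_le_mul_left h hn1
    have hcoef : Real.exp (-r * n) ≤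
        μ0 a * Real.exp (vertexCost p Q g a + r₀) * Real.exp (-r₀ * n) * Real.exp (-δ * n) := by
      have h1 : 1 ≤ μ0 a * Real.exp (vertexCost p Q g a + r₀) * Real.exp (δ * n) :=
        le_trans (by linarith) hexp
      calc Real.exp (-r * n) = 1 * Real.exp (-r * n) := (one_mul _).symm
        _ ≤ _ * Real.exp (-r * n) := mul_le_mul_of_nonneg_right h1 (Real.exp_pos _).le
        _ = _ := by
          simp only [mul_assoc, ← Real.exp_add]
          congr 2
          rw [hδr]
          ring
    calc ENNReal.ofReal (Real.exp (-r * n))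
        ≤ ENNReal.ofReal (μ0 a * Real.exp (vertexCost p Q g a + r₀) * Real.exp (-r₀ * n)) *
            PTree.goodTreeMass (tiltedKernel p Q g) μ (2 * (ρ / 4)) a n := by
          refine (ENNReal.ofReal_le_ofReal hcoef).trans ?_
          rw [ENNReal.ofReal_mul (mul_pos (hw a ha) (Real.exp_pos _)).le]
          exact mul_le_mul_right (hn hex) _
      _ ≤ _ := by
          rw [PTree.goodTreeMass, ← ENNReal.tsum_mul_left]
          refine ENNReal.tsum_le_tsum fun t => ?_
          split_ifs with h h' h'
          · obtain ⟨hsize, hroot, hnear⟩ := h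
            have hlt : dualFn p Q g (empPair t) < r₀ := (hball (hnear_ball t hsize hnear)).2
            rw [PTree.ofReal_jointWeight hp hQ hμ0, hroot,
              PTree.weight_tiltedKernel_eq_mul hp hQ 0 g, hroot, hsize, dualFn_zero hp hQ,
              vertexCost_zero hp hQ, ENNReal.ofReal_mul (hw a ha).le, ENNReal.ofReal_mul (hμ0 a),
              mul_assoc, mul_assoc, mul_comm (PTree.weight _ t)]
            refine mul_le_mul_right ?_ _
            rw [← mul_assoc, ← ENNReal.ofReal_mul (Real.exp_pos _).le, ← Real.exp_add]
            refine mul_le_mul_left (ENNReal.ofReal_le_ofReal (Real.exp_le_exp.2 ?_)) _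
            nlinarith
          · exact absurd ⟨h.1, (hball (hnear_ball t h.1 h.2.2)).1⟩ h'
          · rw [mul_zero]
            exact zero_le
          · rw [mul_zero]
  filter_upwards [eventually_all.2 hgood] with n hn hnS
  obtain ⟨t, ht⟩ : ∃ t : PTree 𝒳,
      (if t.size = n then ENNReal.ofReal (jointWeight p μ0 Q t) else 0) ≠ 0 := by
    by_contra! h
    exact (ENNReal.tsum_eq_zero.2 h).not_gt hnS
  have hsize : t.size = n := by
    by_contra h
    rw [if_neg h] at ht
    exact ht rfl
  rw [if_pos hsize, PTree.ofReal_jointWeight hp hQ hμ0,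
    PTree.weight_tiltedKernel_eq_mul hp hQ 0 g] at ht
  exact hn t.root (ENNReal.ofReal_pos.1 (left_ne_zero_of_mul ht).bot_lt)
    ⟨t, hsize, rfl, left_ne_zero_of_mul (right_ne_zero_of_mul ht)⟩

end EventMass

section Approximation

variable {p : ℕ → ℝ} {Q : 𝒳 → 𝒳 → ℝ} {μ : 𝒳 × 𝒳 → ℝ}

lemma IsProbVec.mix {ν ν' : 𝒳 × 𝒳 → ℝ} (hν : IsProbVec ν) (hν' : IsProbVec ν') {s : ℝ}
    (hs0 : 0 ≤ s) (hs1 : s ≤ 1) : IsProbVec fun x => (1 - s) * ν x + s * ν' x := by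
  refine ⟨fun x => add_nonneg (mul_nonneg (by linarith) (hν.1 x)) (mul_nonneg hs0 (hν'.1 x)), ?_⟩
  rw [Finset.sum_add_distrib, ← Finset.mul_sum, ← Finset.mul_sum, hν.2, hν'.2]
  ring

lemma rate_mix_le (hp : IsCriticalOffspring p) (hQ : IsIrreducibleKernel Q)
    {ν ν' : 𝒳 × 𝒳 → ℝ} (hν : IsProbVec ν) (hν' : IsProbVec ν') {s t : ℝ} (hs : 0 ≤ s) (ht : 0 ≤ t)
    (h : IsProbVec fun x => s * ν x + t * ν' x) :
    rateGWPair p Q (fun x => s * ν x + t * ν' x) ≤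
      (s : EReal) * rateGWPair p Q ν + (t : EReal) * rateGWPair p Q ν' := by
  rw [rate_eq_iSup_dualFn hp hQ h]
  refine iSup_le fun g => ?_
  rw [dualFn_mix, EReal.coe_add, EReal.coe_mul, EReal.coe_mul]
  exact add_le_add
    (mul_le_mul_of_nonneg_left (dualFn_le_rate p hQ hν g) (EReal.coe_nonneg.2 hs))
    (mul_le_mul_of_nonneg_left (dualFn_le_rate p hQ hν' g) (EReal.coe_nonneg.2 ht))

section Stationary

variable {π : 𝒳 → ℝ}

lemma isProbVec_stationary (hQ : IsIrreducibleKernel Q) (hπ : ∀ b, 0 < π b)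
    (hsum : ∑ b, π b = 1) : IsProbVec fun x : 𝒳 × 𝒳 => π x.1 * Q x.1 x.2 := by
  refine ⟨fun x => mul_nonneg (hπ _).le (hQ.nonneg _ _), ?_⟩
  rw [Fintype.sum_prod_type]
  simp_rw [← Finset.mul_sum, hQ.sum_eq_one, mul_one]
  exact hsum

lemma rate_stationary (hp : IsCriticalOffspring p) (hQ : IsIrreducibleKernel Q)
    (hπ : ∀ b, 0 < π b) (hinv : ∀ c, ∑ b, π b * Q b c = π c) :
    rateGWPair p Q (fun x => π x.1 * Q x.1 x.2) = 0 := by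
  have h1 : ∀ a, ∑ b, π a * Q a b = π a := fun a => by
    rw [← Finset.mul_sum, hQ.sum_eq_one, mul_one]
  have hI : cramerRate p 1 = 0 := hp.cramerRate_one.antisymm (hp.cramerRate_nonneg 1)
  simp only [rateGWPair, h1, hinv]
  rw [if_pos fun a h => h]
  simp_rw [div_self (hπ _).ne', hI, mul_zero, Finset.sum_const_zero, add_zero]
  rw [relEnt, if_pos fun a h => h, ENNReal.tsum_eq_zero.2 fun x => ?_]
  · rfl
  · rcases eq_or_ne (π x.1 * Q x.1 x.2) 0 with h | h
    · simp [h]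
    · simp [div_self h]

end Stationary

lemma ac_of_rate_ne_top (hp : IsCriticalOffspring p) (hμ : IsProbVec μ)
    (h : rateGWPair p Q μ ≠ ⊤) :
    (∀ b c, Q b c = 0 → μ (b, c) = 0) ∧
      ∀ b, ∃ k : ℕ, 0 < p k ∧ ∑ c, μ (b, c) ≤ k * ∑ a, μ (a, b) := by
  simp only [rateGWPair] at h
  split_ifs at h with hac
  · have hnonneg : ∀ a, 0 ≤ ((∑ b, μ (b, a) : ℝ) : EReal) *
        cramerRate p ((∑ b, μ (a, b)) / ∑ b, μ (b, a)) := fun a =>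
      mul_nonneg (EReal.coe_nonneg.2 (hμ.snd_nonneg a)) (hp.cramerRate_nonneg _)
    refine ⟨fun b c hbc => ?_, fun b => ?_⟩
    · by_contra hne
      apply h
      rw [relEnt, if_neg]
      · refine EReal.top_add_of_ne_bot (ne_of_gt ?_)
        exact lt_of_lt_of_le EReal.bot_lt_zero (Finset.sum_nonneg fun a _ => hnonneg a)
      · intro hall
        exact hne (hall (b, c) (by simp [hbc]))
    · rcases (hμ.snd_nonneg b).eq_or_lt' with h0 | hpos
      · exact ⟨0, hp.zero_pos, by rw [hac b h0, h0, mul_zero]⟩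
      · obtain ⟨k, hk, hle⟩ := hp.exists_le_of_cramerRate_ne_top
          (x := (∑ c, μ (b, c)) / ∑ a, μ (a, b)) (by
            intro htop
            apply h
            have h2 := Finset.single_le_sum (fun a _ => hnonneg a) (Finset.mem_univ b)
            rw [htop, EReal.coe_mul_top_of_pos hpos, top_le_iff] at h2
            rw [h2]
            exact EReal.add_top_of_ne_bot (EReal.coe_ennreal_ne_bot _))
        exact ⟨k, hk, (div_le_iff₀ hpos).1 hle⟩
  · exact absurd rfl h

lemma exists_isRegularPair (hp : IsCriticalOffspring p) (hQ : IsIrreducibleKernel Q)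
    (hμ : IsProbVec μ) {r : ℝ} (hr : rateGWPair p Q μ < r) {O : Set (𝒳 × 𝒳 → ℝ)} (hO : IsOpen O)
    (hμO : μ ∈ O) :
    ∃ ν, IsRegularPair p Q ν ∧ ν ∈ O ∧ rateGWPair p Q ν < r := by
  have hne : Nonempty 𝒳 := by
    by_contra h
    rw [not_nonempty_iff] at h
    simpa using hμ.2
  obtain ⟨π, hπ, hπsum, hinv⟩ := hQ.exists_stationary
  have hπμ := isProbVec_stationary hQ hπ hπsum
  obtain ⟨hac, hk⟩ := ac_of_rate_ne_top hp hμ (hr.trans_le le_top).ne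
  have hcont : Continuous fun s : ℝ => fun x : 𝒳 × 𝒳 => (1 - s) * μ x + s * (π x.1 * Q x.1 x.2) := by
    fun_prop
  have hnear : ∀ᶠ s : ℝ in nhdsWithin 0 (Set.Ioi 0),
      (fun x : 𝒳 × 𝒳 => (1 - s) * μ x + s * (π x.1 * Q x.1 x.2)) ∈ O := by
    refine (hcont.tendsto 0).eventually_mem ?_ |>.filter_mono nhdsWithin_le_nhds
    simpa using hO.mem_nhds hμO
  obtain ⟨s, hsO, hs0, hs1⟩ := (hnear.and (Ioo_mem_nhdsGT (zero_lt_one (α := ℝ)))).exists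
  have hmix := hμ.mix hπμ hs0.le hs1.le
  have hs1' : 0 < 1 - s := by linarith
  refine ⟨_, ⟨hmix, fun b c => ⟨fun h => ?_, fun h => ?_⟩, ?_⟩, hsO, ?_⟩
  · refine (hQ.nonneg b c).lt_of_ne' fun h0 => h.ne' ?_
    simp [h0, hac b c h0]
  · exact add_pos_of_nonneg_of_pos (mul_nonneg hs1'.le (hμ.1 _)) (mul_pos hs0 (mul_pos (hπ b) h))
  · choose k hpk hle using hk
    obtain ⟨b₀, hb₀⟩ := Finite.exists_max k
    obtain ⟨k₂, hk₂, hpk₂⟩ := hp.exists_two_le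
    refine ⟨max (k b₀) k₂, by rcases max_choice (k b₀) k₂ with h | h <;> rw [h] <;> simp [hpk, hpk₂],
      fun b => ?_⟩
    have h2 : (2 : ℝ) ≤ (max (k b₀) k₂ : ℕ) := by exact_mod_cast hk₂.trans (le_max_right _ _)
    have h3 : (k b : ℝ) ≤ (max (k b₀) k₂ : ℕ) := by exact_mod_cast (hb₀ b).trans (le_max_left _ _)
    have h4 := (hle b).trans (mul_le_mul_of_nonneg_right h3 (hμ.snd_nonneg b))
    simp_rw [Finset.sum_add_distrib, ← Finset.mul_sum, hinv, hQ.sum_eq_one]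
    have h5 := mul_le_mul_of_nonneg_left h4 hs1'.le
    have h6 := mul_le_mul_of_nonneg_right h2 (mul_pos hs0 (hπ b)).le
    have h7 := mul_pos hs0 (hπ b)
    nlinarith
  · refine lt_of_le_of_lt (rate_mix_le hp hQ hμ hπμ hs1'.le hs0.le hmix) ?_
    rw [rate_stationary hp hQ hπ hinv, mul_zero, add_zero]
    refine lt_of_le_of_lt ?_ hr
    exact mul_le_of_le_one_left (rate_nonneg hp hQ hμ)
      (by exact_mod_cast (by linarith : 1 - s ≤ 1))

lemma eventually_le_eventMass (hp : IsCriticalOffspring p) (hQ : IsIrreducibleKernel Q)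
    {μ0 : 𝒳 → ℝ} (hμ0 : ∀ a, 0 ≤ μ0 a) (hμ : IsProbVec μ) {r : ℝ} (hr : rateGWPair p Q μ < r)
    {O : Set (𝒳 × 𝒳 → ℝ)} (hO : IsOpen O) (hμO : μ ∈ O) :
    ∀ᶠ n : ℕ in atTop, n ∈ sizeSupport (jointWeight p μ0 Q) →
      ENNReal.ofReal (Real.exp (-r * n)) ≤
        eventMass (jointWeight p μ0 Q) n {t | empPair t ∈ O} := by
  obtain ⟨ν, hν, hνO, hνr⟩ := exists_isRegularPair hp hQ hμ hr hO hμO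
  exact hν.eventually_le_eventMass hp hQ hμ0 hνr hO hνO

lemma eventually_le_treeMass [Nonempty 𝒳] (hp : IsCriticalOffspring p)
    (hQ : IsIrreducibleKernel Q) {μ0 : 𝒳 → ℝ} (hμ0 : ∀ a, 0 ≤ μ0 a) {δ : ℝ} (hδ : 0 < δ) :
    ∀ᶠ n : ℕ in atTop, n ∈ sizeSupport (jointWeight p μ0 Q) →
      ENNReal.ofReal (Real.exp (-δ * n)) ≤ treeMass (jointWeight p μ0 Q) n := by
  obtain ⟨π, hπ, hπsum, hinv⟩ := hQ.exists_stationary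
  have h := eventually_le_eventMass hp hQ hμ0 (isProbVec_stationary hQ hπ hπsum) (r := δ)
    (by rw [rate_stationary hp hQ hπ hinv]; exact_mod_cast hδ) isOpen_univ (Set.mem_univ _)
  filter_upwards [h] with n hn hnS
  rw [treeMass_eq_eventMass]
  exact hn hnS

lemma eventually_condP_le [Nonempty 𝒳] (hp : IsCriticalOffspring p)
    (hQ : IsIrreducibleKernel Q) {μ0 : 𝒳 → ℝ} (hμ0 : ∀ a, 0 ≤ μ0 a) (hμ0_sum : ∑ a, μ0 a = 1)
    {F : Set (𝒳 × 𝒳 → ℝ)} (hF : IsCompact F) (hFv : ∀ ν ∈ F, IsProbVec ν) {α β : ℝ} (hβα : β < α)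
    (hα : ∀ ν ∈ F, (α : EReal) < rateGWPair p Q ν) :
    ∀ᶠ n : ℕ in atTop, n ∈ sizeSupport (jointWeight p μ0 Q) →
      condP (jointWeight p μ0 Q) n {t | empPair t ∈ F} ≤ ENNReal.ofReal (Real.exp (-β * n)) := by
  classical
  obtain ⟨B, hB, hbd⟩ := PTree.exists_tsum_weight_le hp hQ 0 hF (α := α) fun ν hν => by
    have h := hα ν hν
    rw [rate_eq_iSup_dualFn hp hQ (hFv ν hν), lt_iSup_iff] at h
    obtain ⟨g, hg⟩ := h
    exact ⟨g, by rw [dualFn_zero hp hQ, sub_zero]; exact_mod_cast hg⟩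
  obtain ⟨δ, hδ, hδα⟩ : ∃ δ, 0 < δ ∧ α = β + δ + δ := ⟨(α - β) / 2, by linarith, by ring⟩
  have hw : 0 < (Real.exp α * (B.toReal + 1))⁻¹ :=
    inv_pos.2 (mul_pos (Real.exp_pos _) (by positivity))
  filter_upwards [eventually_le_treeMass hp hQ hμ0 hδ, PTree.eventually_nat_le_mul_exp hw hδ,
    eventually_ge_atTop 1] with n hn hexp hn1 hnS
  have hbound : eventMass (jointWeight p μ0 Q) n {t | empPair t ∈ F} ≤
      ENNReal.ofReal (Real.exp (-β * n) * Real.exp (-δ * n)) := by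
    calc eventMass (jointWeight p μ0 Q) n {t | empPair t ∈ F}
        ≤ ∑' t : PTree 𝒳, if t.size = n - 1 + 1 ∧ empPair t ∈ F
            then PTree.weight (tiltedKernel p Q 0) t else 0 := by
          rw [Nat.sub_add_cancel hn1]
          refine ENNReal.tsum_le_tsum fun t => ?_
          by_cases ht : t.size = n ∧ t ∈ {t : PTree 𝒳 | empPair t ∈ F}
          · rw [if_pos ht, if_pos (show t.size = n ∧ empPair t ∈ F from ht), PTree.ofReal_jointWeight hp hQ hμ0]
            refine mul_le_of_le_one_left zero_le (ENNReal.ofReal_le_one.2 ?_)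
            rw [← hμ0_sum]
            exact Finset.single_le_sum (fun a _ => hμ0 a) (Finset.mem_univ _)
          · rw [if_neg ht]
            exact zero_le
      _ ≤ B * ENNReal.ofReal (Real.exp (-α * (n - 1 : ℕ))) := hbd _ _ fun t ht => ht
      _ ≤ ENNReal.ofReal (B.toReal + 1) * ENNReal.ofReal (Real.exp (-α * (n - 1 : ℕ))) := by
          refine mul_le_mul_left ?_ _
          rw [ENNReal.le_ofReal_iff_toReal_le hB (by positivity)]
          linarith
      _ ≤ _ := by
          rw [← ENNReal.ofReal_mul (by positivity)]
          refine ENNReal.ofReal_le_ofReal ?_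
          have h1 : (1 : ℝ) ≤ (Real.exp α * (B.toReal + 1))⁻¹ * Real.exp (δ * n) :=
            le_trans (by exact_mod_cast hn1) hexp
          have h2 : Real.exp α * (B.toReal + 1) ≤ Real.exp (δ * n) := by
            rwa [inv_mul_eq_div, le_div_iff₀ (inv_pos.1 hw), one_mul] at h1
          calc (B.toReal + 1) * Real.exp (-α * (n - 1 : ℕ))
              = Real.exp α * (B.toReal + 1) * Real.exp (-α * n) := by
                rw [Nat.cast_pred (by omega), mul_right_comm, ← Real.exp_add, mul_comm]
                congr 2
                ring
            _ ≤ Real.exp (δ * n) * Real.exp (-α * n) :=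
                mul_le_mul_of_nonneg_right h2 (Real.exp_pos _).le
            _ = _ := by
                rw [← Real.exp_add, ← Real.exp_add]
                congr 1
                rw [hδα]
                ring
  rw [condP_eq]
  refine ENNReal.div_le_of_le_mul (hbound.trans ?_)
  rw [ENNReal.ofReal_mul (Real.exp_pos _).le]
  exact mul_le_mul_right (hn hnS) _

end Approximation

section ExtendedReal

lemma elog_ofReal_exp (x : ℝ) : elog (ENNReal.ofReal (Real.exp x)) = x := by
  rw [elog, if_neg (ENNReal.ofReal_pos.2 (Real.exp_pos x)).ne', if_neg ENNReal.ofReal_ne_top,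
    ENNReal.toReal_ofReal (Real.exp_pos x).le, Real.log_exp]

lemma elog_mono : Monotone elog := by
  intro x y hxy
  rcases eq_or_ne x 0 with rfl | hx
  · simp [elog]
  rcases eq_or_ne y ∞ with rfl | hy
  · simp [elog]
  have hx' : x ≠ ∞ := (hxy.trans_lt hy.lt_top).ne
  have hy' : y ≠ 0 := (hx.bot_lt.trans_le hxy).ne'
  rw [elog, elog, if_neg hx, if_neg hx', if_neg hy', if_neg hy, EReal.coe_le_coe_iff]
  exact Real.log_le_log (ENNReal.toReal_pos hx hx') (ENNReal.toReal_mono hy hxy)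

lemma inv_mul_elog_ofReal_exp {n : ℕ} (hn : 0 < n) (r : ℝ) :
    (((n : ℝ)⁻¹ : ℝ) : EReal) * elog (ENNReal.ofReal (Real.exp (r * n))) = r := by
  rw [elog_ofReal_exp, ← EReal.coe_mul, mul_comm r, inv_mul_cancel_left₀ (by positivity)]

lemma inv_mul_elog_mono (n : ℕ) :
    Monotone fun x : ℝ≥0∞ => (((n : ℝ)⁻¹ : ℝ) : EReal) * elog x := fun _ _ hxy =>
  mul_le_mul_of_nonneg_left (elog_mono hxy) (EReal.coe_nonneg.2 (by positivity))

lemma inv_mul_elog_le {n : ℕ} (hn : 0 < n) {x : ℝ≥0∞} {r : ℝ}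
    (h : x ≤ ENNReal.ofReal (Real.exp (r * n))) : (((n : ℝ)⁻¹ : ℝ) : EReal) * elog x ≤ r :=
  (inv_mul_elog_mono n h).trans_eq (inv_mul_elog_ofReal_exp hn r)

lemma le_inv_mul_elog {n : ℕ} (hn : 0 < n) {x : ℝ≥0∞} {r : ℝ}
    (h : ENNReal.ofReal (Real.exp (r * n)) ≤ x) : (r : EReal) ≤ (((n : ℝ)⁻¹ : ℝ) : EReal) * elog x :=
  (inv_mul_elog_ofReal_exp hn r).symm.trans_le (inv_mul_elog_mono n h)

end ExtendedReal

theorem ldp_empirical_pair_measure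
    (p : ℕ → ℝ) (hp_nonneg : ∀ n, 0 ≤ p n) (hp_sum : HasSum p 1)
    (hp0 : 0 < p 0) (hp01 : p 0 < 1 - p 1)
    (hp_mean : HasSum (fun n : ℕ => (n : ℝ) * p n) 1)
    (hp_tail : Filter.Tendsto
      (fun n : ℕ => (((n : ℝ)⁻¹ : ℝ) : EReal) * elog (ENNReal.ofReal (p n)))
      Filter.atTop (nhds ⊥))
    (μ0 : 𝒳 → ℝ) (hμ0_nonneg : ∀ a, 0 ≤ μ0 a) (hμ0_sum : ∑ a, μ0 a = 1)
    (Q : 𝒳 → 𝒳 → ℝ) (hQ_nonneg : ∀ a b, 0 ≤ Q a b) (hQ_sum : ∀ a, ∑ b, Q a b = 1)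
    (hQ_irr : ∀ a b, ∃ k : ℕ, 0 < ((Matrix.of Q) ^ (k + 1)) a b)
    (I : PV 𝒳 → EReal) (hI : ∀ μ, I μ = rateGWPair p Q μ.1)
    (S : Set ℕ) (hS : S = sizeSupport (jointWeight p μ0 Q)) :
    -- `I` is convex
    (∀ (μ ν : PV 𝒳) (θ : ℝ), 0 ≤ θ → θ ≤ 1 →
      ∀ h : IsProbVec (fun x => θ * μ.1 x + (1 - θ) * ν.1 x),
        I ⟨fun x => θ * μ.1 x + (1 - θ) * ν.1 x, h⟩
          ≤ (θ : EReal) * I μ + ((1 - θ : ℝ) : EReal) * I ν) ∧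
    -- `I` is a good rate function
    LowerSemicontinuous I ∧
    (∀ c : ℝ, IsCompact {μ : PV 𝒳 | I μ ≤ (c : EReal)}) ∧
    -- large deviation upper bound, conditionally on `{|T| = n}`, along `n ∈ S`
    (∀ F : Set (PV 𝒳), IsClosed F →
      Filter.limsup
        (fun n : ℕ => (((n : ℝ)⁻¹ : ℝ) : EReal) *
          elog (condP (jointWeight p μ0 Q) n
            {t | ∃ h : IsProbVec (empPair t), (⟨empPair t, h⟩ : PV 𝒳) ∈ F}))
        (Filter.atTop ⊓ Filter.principal S)
        ≤ - ⨅ μ ∈ F, I μ) ∧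
    -- large deviation lower bound
    (∀ O : Set (PV 𝒳), IsOpen O →
      - ⨅ μ ∈ O, I μ ≤
      Filter.liminf
        (fun n : ℕ => (((n : ℝ)⁻¹ : ℝ) : EReal) *
          elog (condP (jointWeight p μ0 Q) n
            {t | ∃ h : IsProbVec (empPair t), (⟨empPair t, h⟩ : PV 𝒳) ∈ O}))
        (Filter.atTop ⊓ Filter.principal S)) := by
  have hp : IsCriticalOffspring p := ⟨hp_nonneg, hp_sum, hp0, hp_mean,
    exists_two_le_of_zero_lt hp_nonneg hp_sum hp01,
    summable_mul_exp_of_superexponential_tail hp_nonneg hp_tail⟩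
  have hQ : IsIrreducibleKernel Q := ⟨hQ_nonneg, hQ_sum, hQ_irr⟩
  have hne : Nonempty 𝒳 := by
    by_contra h
    rw [not_nonempty_iff] at h
    simp at hμ0_sum
  have hlsc : LowerSemicontinuous I := by
    have hI' : I = fun μ => ⨆ g : 𝒳 → 𝒳 → ℝ, (dualFn p Q g μ.1 : EReal) :=
      funext fun μ => by rw [hI, rate_eq_iSup_dualFn hp hQ μ.2]
    rw [hI']
    exact lowerSemicontinuous_iSup fun g => (continuous_coe_real_ereal.comp
      ((continuous_dualFn p Q g).comp continuous_subtype_val)).lowerSemicontinuous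
  have hPV : CompactSpace (PV 𝒳) := isCompact_iff_compactSpace.1 isCompact_isProbVec
  refine ⟨fun μ ν θ h0 h1 h => ?_, hlsc, fun c => ?_, fun F hF => ?_, fun O hO => ?_⟩
  · rw [hI, hI, hI]
    exact rate_mix_le hp hQ μ.2 ν.2 h0 (sub_nonneg.2 h1) h
  · exact (hlsc.isClosed_preimage c).isCompact
  · rw [EReal.le_neg]
    refine EReal.ge_of_forall_gt_iff_ge.1 fun β hβ => ?_
    rw [EReal.le_neg, ← EReal.coe_neg]
    obtain ⟨α, hβα, hα⟩ := EReal.lt_iff_exists_real_btwn.1 hβ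
    refine limsup_le_of_le (by isBoundedDefault) ?_
    rw [eventually_inf_principal]
    filter_upwards [eventually_condP_le hp hQ hμ0_nonneg hμ0_sum
      (hF.isCompact.image continuous_subtype_val) (by rintro _ ⟨ν, -, rfl⟩; exact ν.2)
      (EReal.coe_lt_coe_iff.1 hβα) (by
        rintro _ ⟨ν, hν, rfl⟩
        rw [← hI]
        exact hα.trans_le (iInf₂_le ν hν)), eventually_ge_atTop 1] with n hn hn1 hnS
    refine inv_mul_elog_le hn1 (le_trans ?_ (hn (hS ▸ hnS)))
    rw [condP_eq, condP_eq]
    refine ENNReal.div_le_div_right (eventMass_mono _ ?_) _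
    rintro t - ⟨h, ht⟩
    exact ⟨⟨empPair t, h⟩, ht, rfl⟩
  · rw [EReal.neg_le]
    refine le_iInf₂ fun μ hμ => EReal.le_of_forall_lt_iff_le.1 fun r hr => ?_
    rw [EReal.neg_le, ← EReal.coe_neg]
    obtain ⟨O', hO', rfl⟩ := isOpen_induced_iff.1 hO
    rw [hI] at hr
    refine le_liminf_of_le (by isBoundedDefault) ?_
    rw [eventually_inf_principal]
    filter_upwards [eventually_le_eventMass hp hQ hμ0_nonneg μ.2 hr hO' hμ,
      eventually_ge_atTop 2] with n hn hn2 hnS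
    refine le_inv_mul_elog (by omega) ((hn (hS ▸ hnS)).trans ?_)
    rw [condP_eq]
    refine le_trans (eventMass_mono _ ?_) (ENNReal.le_div_iff_mul_le (Or.inl (hS ▸ hnS : n ∈ sizeSupport _).ne')
      (Or.inl ((treeMass_jointWeight_le_one hp hQ hμ0_nonneg hμ0_sum n).trans_lt
        ENNReal.one_lt_top).ne) |>.2 (mul_le_of_le_one_right zero_le
          (treeMass_jointWeight_le_one hp hQ hμ0_nonneg hμ0_sum n)))
    intro t ht h
    exact ⟨PTree.isProbVec_empPair t (ht ▸ hn2), h⟩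

end Statement0
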